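/- Let $M_n$ be the $n\times n$ real symmetric matrix with entries $M_n(j,k) = \frac{1}{\sqrt{2\pi}}\,\frac{\Gamma(j+k-3/2)}{\sqrt{\Gamma(2j-1)\Gamma(2k-1)}}$ for $1\le j,k\le n$, and for $0\le k\le n$ let $c_{n,k}$ denote the coefficient of $z^k$ in the polynomial $z \mapsto \det(I_n + (z-1) M_n)$. Then for every fixed non-negative integer $k$, $\lim_{n\to\infty} \frac{1}{\sqrt{2n}} \log c_{n,k} = -\frac{1}{\sqrt{2\pi}}\,\zeta(3/2)$, where $\zeta$ is the Riemann zeta function. -/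

import Mathlib

/-- The `n × n` real symmetric matrix with entries
`M_n(j,k) = Γ(j+k-3/2) / (√(2π) √(Γ(2j-1) Γ(2k-1)))` for `1 ≤ j,k ≤ n`. -/
noncomputable def ginibreM (n : ℕ) : Matrix (Fin n) (Fin n) ℝ :=
  Matrix.of fun j k =>
    (1 / Real.sqrt (2 * Real.pi)) *
      Real.Gamma (((j : ℕ) + 1 : ℝ) + ((k : ℕ) + 1 : ℝ) - 3 / 2) /
        Real.sqrt (Real.Gamma (2 * ((j : ℕ) + 1 : ℝ) - 1) *
          Real.Gamma (2 * ((k : ℕ) + 1 : ℝ) - 1))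

/-- The coefficient of `z^k` in the polynomial `z ↦ det(I_n + (z-1) M_n)`. -/
noncomputable def ginibreCoeff (n k : ℕ) : ℝ :=
  (Matrix.det ((1 : Matrix (Fin n) (Fin n) (Polynomial ℝ)) +
    (Polynomial.X - 1 : Polynomial ℝ) • (ginibreM n).map Polynomial.C)).coeff k

open Filter Topology MeasureTheory ProbabilityTheory
open scoped ENNReal NNReal

/-- The normalized central binomial coefficient `C(2n, n) / 4^n`. -/
noncomputable def centralRatio (n : ℕ) : ℝ := n.centralBinom / 4 ^ n

namespace centralRatio

lemma zero : centralRatio 0 = 1 := by simp [centralRatio]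

lemma succ (n : ℕ) : centralRatio (n + 1) = centralRatio n * ((2 * n + 1) / (2 * n + 2)) := by
  have h := Nat.succ_mul_centralBinom_succ n
  have h' : ((n : ℝ) + 1) * (n + 1).centralBinom = 2 * (2 * n + 1) * n.centralBinom := by
    exact_mod_cast h
  unfold centralRatio
  rw [pow_succ]
  field_simp
  linarith

lemma pos (n : ℕ) : 0 < centralRatio n :=
  div_pos (by exact_mod_cast n.centralBinom_pos) (by positivity)

lemma antitone : Antitone centralRatio := by
  refine antitone_nat_of_succ_le fun n => ?_
  rw [succ]
  refine mul_le_of_le_one_right (pos n).le ?_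
  rw [div_le_one (by positivity)]
  linarith

lemma le_one (n : ℕ) : centralRatio n ≤ 1 := zero ▸ antitone (Nat.zero_le n)

lemma sq_mul_le_one (n : ℕ) : centralRatio n ^ 2 * (n + 1) ≤ 1 := by
  induction n with
  | zero => simp [zero]
  | succ n ih =>
    rw [succ]
    refine le_trans ?_ ih
    have hb := sq_nonneg (centralRatio n)
    push_cast
    have : ((2 * (n : ℝ) + 1) / (2 * n + 2)) ^ 2 * (n + 1 + 1) ≤ n + 1 := by
      rw [div_pow, div_mul_eq_mul_div, div_le_iff₀ (by positivity)]
      nlinarith [(Nat.cast_nonneg n : (0 : ℝ) ≤ n)]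
    calc _ = centralRatio n ^ 2 * (((2 * (n : ℝ) + 1) / (2 * n + 2)) ^ 2 * (n + 1 + 1)) := by ring
      _ ≤ _ := mul_le_mul_of_nonneg_left this hb

lemma le_inv_sqrt (n : ℕ) : centralRatio n ≤ 1 / √(n + 1) := by
  rw [le_div_iff₀ (by positivity)]
  refine abs_le_of_sq_le_sq' ?_ zero_le_one |>.2
  rw [mul_pow, Real.sq_sqrt (by positivity)]
  simpa using sq_mul_le_one n

lemma wallis (n : ℕ) : Real.Wallis.W n * (centralRatio n ^ 2 * (2 * n + 1)) = 1 := by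
  induction n with
  | zero => simp [zero, Real.Wallis.W]
  | succ n ih =>
    rw [Real.Wallis.W_succ, succ]
    refine Eq.trans ?_ ih
    push_cast
    field_simp
    ring

lemma tendsto_sqrt_mul : Tendsto (fun n : ℕ => √n * centralRatio n) atTop (𝓝 (1 / √Real.pi)) := by
  have h1 : Tendsto (fun n : ℕ => (Real.Wallis.W n)⁻¹ * ((n : ℝ) / (2 * n + 1))) atTop
      (𝓝 ((Real.pi / 2)⁻¹ * (1 / 2))) :=
    (Real.Wallis.tendsto_W_nhds_pi_div_two.inv₀ (by positivity)).mul
      Stirling.tendsto_self_div_two_mul_self_add_one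
  have h2 := (Real.continuous_sqrt.tendsto _).comp h1
  convert h2 using 2 with n
  · have hW : (Real.Wallis.W n)⁻¹ = centralRatio n ^ 2 * (2 * n + 1) :=
      inv_eq_of_mul_eq_one_right (wallis n)
    simp only [Function.comp]
    rw [hW]
    have : centralRatio n ^ 2 * (2 * n + 1) * ((n : ℝ) / (2 * n + 1)) = n * centralRatio n ^ 2 := by
      field_simp
    rw [this, Real.sqrt_mul (by positivity), Real.sqrt_sq (pos n).le]
  · rw [show (Real.pi / 2)⁻¹ * (1 / 2) = 1 / Real.pi by field_simp]
    rw [Real.sqrt_div zero_le_one, Real.sqrt_one]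

lemma gamma_add_half (n : ℕ) :
    Real.Gamma (n + 1 / 2) = √Real.pi * (n.factorial * centralRatio n) := by
  induction n with
  | zero => rw [zero, ← Real.Gamma_one_half_eq]; simp
  | succ n ih =>
    rw [show ((n + 1 : ℕ) : ℝ) + 1 / 2 = (n + 1 / 2) + 1 by push_cast; ring,
      Real.Gamma_add_one (by positivity), ih, succ, Nat.factorial_succ]
    push_cast
    field_simp

lemma hasSum {x : ℝ} (hx : |x| < 1) :
    HasSum (fun n => centralRatio n * x ^ n) (1 / √(1 - x)) := by
  have h := (Real.one_div_one_sub_rpow_hasFPowerSeriesOnBall_zero (1 / 2)).hasSum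
    (y := x) (by simpa [enorm_eq_nnnorm, ← NNReal.coe_lt_coe] using hx)
  rw [zero_add, ← Real.sqrt_eq_rpow] at h
  simp only [FormalMultilinearSeries.ofScalars_apply_eq, smul_eq_mul] at h
  convert! h using 3 with n
  rw [← Ring.multichoose_eq]
  have h1 := Ring.factorial_nsmul_multichoose_eq_ascPochhammer (1 / 2 : ℝ) n
  rw [Polynomial.ascPochhammer_smeval_eq_eval, nsmul_eq_mul] at h1
  have h2 : (n.factorial : ℝ) * centralRatio n = (ascPochhammer ℝ n).eval (1 / 2) := by
    clear h h1
    induction n with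
    | zero => simp [zero]
    | succ n ih =>
      rw [ascPochhammer_succ_eval, ← ih, succ, Nat.factorial_succ]
      push_cast
      field_simp
      ring
  have h3 : (n.factorial : ℝ) ≠ 0 := by positivity
  exact mul_left_cancel₀ h3 (h2.trans h1.symm)

end centralRatio

lemma integrable_pow_mul_exp_neg_mul_sq {β : ℝ} (hβ : 0 < β) (k : ℕ) :
    Integrable fun x : ℝ => x ^ k * Real.exp (-β * x ^ 2) := by
  simpa using integrable_rpow_mul_exp_neg_mul_sq hβ (s := k)
    (lt_of_lt_of_le (by norm_num) (Nat.cast_nonneg k))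

lemma integral_even_pow_mul_exp_neg_mul_sq {β : ℝ} (hβ : 0 < β) (k : ℕ) :
    ∫ x : ℝ, x ^ (2 * k) * Real.exp (-β * x ^ 2) =
      √(Real.pi / β) * (k.factorial * centralRatio k / β ^ k) := by
  have h1 := integral_comp_abs (f := fun x : ℝ => x ^ (2 * k) * Real.exp (-β * x ^ 2))
  simp only [sq_abs, (even_two_mul k).pow_abs] at h1
  have h2 := integral_rpow_mul_exp_neg_mul_rpow (p := 2) (q := (2 * k : ℕ)) two_pos
    (lt_of_lt_of_le (by norm_num) (Nat.cast_nonneg _)) hβ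
  simp only [Real.rpow_natCast, Real.rpow_two] at h2
  rw [h1, h2, show (((2 * k : ℕ) : ℝ) + 1) / 2 = k + 1 / 2 by push_cast; ring,
    centralRatio.gamma_add_half, show -(((2 * k : ℕ) : ℝ) + 1) / 2 = -(k + 1 / 2) by push_cast; ring,
    Real.rpow_neg hβ.le, Real.rpow_add hβ, Real.rpow_natCast, ← Real.sqrt_eq_rpow,
    Real.sqrt_div Real.pi_pos.le]
  field_simp

/-- The coefficient of `t ^ N` in `((1 - t) * (1 + r * t)) ^ (-1 / 2)`. -/
noncomputable def twistedRatio (r : ℝ) (N : ℕ) : ℝ :=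
  ∑ j ∈ Finset.range (N + 1), centralRatio (N - j) * centralRatio j * (-r) ^ j

lemma tendsto_sqrt_add_div_sqrt (j : ℕ) :
    Tendsto (fun n : ℕ => √((n : ℝ) + j) / √n) atTop (𝓝 1) := by
  have h : Tendsto (fun n : ℕ => √(1 + (j : ℝ) / n)) atTop (𝓝 √(1 + 0)) :=
    (Real.continuous_sqrt.tendsto _).comp
      (tendsto_const_nhds.add (tendsto_const_div_atTop_nhds_zero_nat _))
  rw [add_zero, Real.sqrt_one] at h
  refine h.congr' ?_
  filter_upwards [eventually_gt_atTop 0] with n hn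
  rw [← Real.sqrt_div (by positivity)]
  congr 1
  field_simp

lemma tendsto_sqrt_mul_centralRatio_sub (j : ℕ) :
    Tendsto (fun N : ℕ => √N * centralRatio (N - j)) atTop (𝓝 (1 / √Real.pi)) := by
  rw [← tendsto_add_atTop_iff_nat j]
  have h := (tendsto_sqrt_add_div_sqrt j).mul centralRatio.tendsto_sqrt_mul
  rw [one_mul] at h
  refine h.congr' ?_
  filter_upwards [eventually_gt_atTop 0] with n hn
  have : √(n : ℝ) ≠ 0 := by positivity
  rw [Nat.add_sub_cancel]
  push_cast
  field_simp

lemma tendsto_sqrt_mul_twistedRatio {r : ℝ} (h0 : 0 ≤ r) (h1 : r < 1) :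
    Tendsto (fun N : ℕ => √N * twistedRatio r N) atTop (𝓝 (1 / √Real.pi * (1 / √(1 + r)))) := by
  have habs : |(-r)| < 1 := by rwa [abs_neg, abs_of_nonneg h0]
  have hs : Summable fun j : ℕ => ((j : ℝ) + 1) * r ^ j := by
    have := (summable_pow_mul_geometric_of_norm_lt_one 1 (r := r)
      (by rwa [Real.norm_of_nonneg h0])).add (summable_geometric_of_lt_one h0 h1)
    refine this.congr fun j => ?_
    ring
  have key := tendsto_tsum_of_dominated_convergence (𝓕 := atTop)
    (f := fun (N : ℕ) (j : ℕ) =>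
      if j ∈ Finset.range (N + 1) then √N * (centralRatio (N - j) * centralRatio j * (-r) ^ j) else 0)
    (g := fun j => 1 / √Real.pi * (centralRatio j * (-r) ^ j)) hs ?_ ?_
  · rw [tsum_mul_left, (centralRatio.hasSum habs).tsum_eq, sub_neg_eq_add] at key
    refine key.congr fun N => ?_
    rw [tsum_eq_sum (s := Finset.range (N + 1)) (fun j hj => if_neg hj), twistedRatio,
      Finset.mul_sum]
    exact Finset.sum_congr rfl fun j hj => if_pos hj
  · intro j
    refine ((tendsto_sqrt_mul_centralRatio_sub j).mul_const (centralRatio j * (-r) ^ j)).congr' ?_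
    filter_upwards [eventually_ge_atTop j] with N hN
    rw [if_pos (Finset.mem_range.2 (by omega))]
    ring
  · refine Eventually.of_forall fun N j => ?_
    split_ifs with hj
    · rw [Finset.mem_range, Nat.lt_succ_iff] at hj
      rw [norm_mul, norm_mul, norm_mul, norm_pow, norm_neg, Real.norm_of_nonneg h0,
        Real.norm_of_nonneg (Real.sqrt_nonneg _), Real.norm_of_nonneg (centralRatio.pos _).le,
        Real.norm_of_nonneg (centralRatio.pos _).le]
      have e1 : √(N : ℝ) * centralRatio (N - j) ≤ j + 1 := by
        refine (mul_le_mul_of_nonneg_left (centralRatio.le_inv_sqrt _) (Real.sqrt_nonneg _)).trans ?_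
        rw [mul_one_div, div_le_iff₀ (by positivity)]
        refine Real.sqrt_le_iff.2 ⟨by positivity, ?_⟩
        rw [mul_pow, Real.sq_sqrt (by positivity), Nat.cast_sub hj]
        have hj' : (j : ℝ) ≤ N := by exact_mod_cast hj
        have hj0 : (0 : ℝ) ≤ j := Nat.cast_nonneg j
        nlinarith [mul_nonneg hj0 (sub_nonneg.2 hj'), mul_nonneg hj0 (mul_nonneg hj0 (sub_nonneg.2 hj'))]
      have e2 : centralRatio j * r ^ j ≤ r ^ j :=
        mul_le_of_le_one_left (pow_nonneg h0 _) (centralRatio.le_one j)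
      calc _ = (√(N : ℝ) * centralRatio (N - j)) * (centralRatio j * r ^ j) := by ring
        _ ≤ _ := mul_le_mul e1 e2 (mul_nonneg (centralRatio.pos _).le (pow_nonneg h0 _))
          (by positivity)
    · simp only [norm_zero]
      positivity

lemma tendsto_sum_div_sqrt {t : ℕ → ℝ} {c : ℝ}
    (h : Tendsto (fun n : ℕ => √(2 * n) * t n) atTop (𝓝 c)) :
    Tendsto (fun n : ℕ => (∑ i ∈ Finset.range n, t i) / √(2 * n)) atTop (𝓝 c) := by
  set g : ℕ → ℝ := fun n => √((n : ℝ) + 1) - √n with hg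
  have hsum (n : ℕ) : ∑ i ∈ Finset.range n, g i = √n := by
    have := Finset.sum_range_sub (fun i : ℕ => √(i : ℝ)) n
    simpa [hg] using this
  have hpos (n : ℕ) : 0 < g n := sub_pos.2 (Real.sqrt_lt_sqrt (by positivity) (by linarith))
  have hmul (n : ℕ) : (√((n : ℝ) + 1) + √n) * g n = 1 := by
    have e1 := Real.sq_sqrt (show (0 : ℝ) ≤ (n : ℝ) + 1 by positivity)
    have e2 := Real.sq_sqrt (show (0 : ℝ) ≤ (n : ℝ) by positivity)
    simp only [hg]
    nlinarith
  have hs2 : √(2 : ℝ) ≠ 0 := by positivity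
  have hs2' : √(2 : ℝ) ^ 2 = 2 := Real.sq_sqrt (by norm_num)
  have hratio : Tendsto (fun n => t n / g n) atTop (𝓝 (c * √2)) := by
    have h1 : Tendsto (fun n : ℕ => (√(2 * n) * t n) * ((√((n : ℝ) + (1 : ℕ)) / √n + 1) / √2)) atTop
        (𝓝 (c * ((1 + 1) / √2))) :=
      h.mul (((tendsto_sqrt_add_div_sqrt 1).add_const 1).div_const _)
    have : c * ((1 + 1) / √2) = c * √2 := by
      field_simp
      rw [hs2']
      norm_num
    rw [this] at h1
    refine h1.congr' ?_
    filter_upwards [eventually_gt_atTop 0] with n hn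
    have h3 : √(n : ℝ) ≠ 0 := by positivity
    have h4 : t n / g n = t n * (√((n : ℝ) + 1) + √n) := by
      rw [div_eq_iff (hpos n).ne', mul_assoc, hmul, mul_one]
    rw [h4, Real.sqrt_mul (by norm_num)]
    push_cast
    field_simp
  have hlo : (fun n => t n - c * √2 * g n) =o[atTop] g := by
    rw [Asymptotics.isLittleO_iff_tendsto fun n hn => absurd hn (hpos n).ne']
    have := hratio.sub_const (c * √2)
    rw [sub_self] at this
    refine this.congr fun n => ?_
    have := (hpos n).ne'
    field_simp
  have hS := hlo.sum_range (fun n => (hpos n).le) (by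
    simp only [hsum]
    exact Real.tendsto_sqrt_atTop.comp tendsto_natCast_atTop_atTop)
  simp only [hsum, Finset.sum_sub_distrib, ← Finset.mul_sum] at hS
  have h5 := ((hS.tendsto_div_nhds_zero).div_const √2).add_const c
  rw [zero_div, zero_add] at h5
  refine h5.congr' ?_
  filter_upwards [eventually_gt_atTop 0] with n hn
  have h3 : √(n : ℝ) ≠ 0 := by positivity
  rw [Real.sqrt_mul (by norm_num)]
  field_simp
  ring

/-- The functions `x ^ (2a) * exp (-x² / 2) / √(2a)!`, whose Gram matrix is `√(2π) M_n`. -/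
noncomputable def evenGauss (a : ℕ) (x : ℝ) : ℝ :=
  x ^ (2 * a) * Real.exp (-x ^ 2 / 2) / √((2 * a).factorial)

/-- The entries of the infinite matrix of which `ginibreM n` is the leading block. -/
noncomputable def ginibreEntry (a b : ℕ) : ℝ :=
  1 / √(2 * Real.pi) * Real.Gamma (a + b + 1 / 2) / √((2 * a).factorial * (2 * b).factorial)

lemma ginibreM_apply (n : ℕ) (i j : Fin n) : ginibreM n i j = ginibreEntry i j := by
  have h (m : ℕ) : Real.Gamma (2 * ((m : ℝ) + 1) - 1) = (2 * m).factorial := by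
    rw [← Real.Gamma_nat_eq_factorial]
    congr 1
    push_cast
    ring
  rw [ginibreM, Matrix.of_apply, h, h, ginibreEntry]
  congr 3
  ring

namespace evenGauss

lemma nonneg (a : ℕ) (x : ℝ) : 0 ≤ evenGauss a x := by
  unfold evenGauss
  have := (even_two_mul a).pow_nonneg x
  positivity

lemma neg (a : ℕ) (x : ℝ) : evenGauss a (-x) = evenGauss a x := by
  simp [evenGauss, (even_two_mul a).neg_pow]

@[fun_prop]
lemma continuous (a : ℕ) : Continuous (evenGauss a) := by
  unfold evenGauss
  fun_prop

lemma mul_eq (a b : ℕ) (x : ℝ) : evenGauss a x * evenGauss b x =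
    1 / √((2 * a).factorial * (2 * b).factorial) *
      (x ^ (2 * (a + b)) * Real.exp (-1 * x ^ 2)) := by
  have : Real.exp (-1 * x ^ 2) = Real.exp (-x ^ 2 / 2) * Real.exp (-x ^ 2 / 2) := by
    rw [← Real.exp_add]
    ring_nf
  rw [evenGauss, evenGauss, this, Real.sqrt_mul (by positivity)]
  field_simp
  ring

lemma integrable_mul (a b : ℕ) : Integrable fun x => evenGauss a x * evenGauss b x := by
  simp only [mul_eq]
  exact (integrable_pow_mul_exp_neg_mul_sq one_pos _).const_mul _

lemma integral_mul (a b : ℕ) :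
    1 / √(2 * Real.pi) * ∫ x, evenGauss a x * evenGauss b x = ginibreEntry a b := by
  simp only [mul_eq]
  rw [integral_const_mul, integral_even_pow_mul_exp_neg_mul_sq one_pos, ginibreEntry,
    show (a : ℝ) + b + 1 / 2 = (a + b : ℕ) + 1 / 2 by push_cast; ring,
    centralRatio.gamma_add_half]
  simp only [div_one, one_pow]
  ring

lemma lintegral_mul (a b : ℕ) :
    ENNReal.ofReal (1 / √(2 * Real.pi)) *
      ∫⁻ x, ENNReal.ofReal (evenGauss a x) * ENNReal.ofReal (evenGauss b x) =
      ENNReal.ofReal (ginibreEntry a b) := by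
  simp only [← ENNReal.ofReal_mul (nonneg _ _)]
  rw [← ofReal_integral_eq_lintegral_ofReal (integrable_mul a b)
    (ae_of_all _ fun x => mul_nonneg (nonneg _ _) (nonneg _ _)),
    ← ENNReal.ofReal_mul (by positivity), integral_mul]

lemma eq_mul (a : ℕ) (x : ℝ) : evenGauss a x =
    1 / √((2 * a).factorial) * (x ^ (2 * a) * Real.exp (-(1 / 2) * x ^ 2)) := by
  rw [evenGauss, show -(1 / 2) * x ^ 2 = -x ^ 2 / 2 by ring]
  ring

lemma integrable (a : ℕ) : Integrable (evenGauss a) := by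
  have : evenGauss a = _ := funext (eq_mul a)
  rw [this]
  exact (integrable_pow_mul_exp_neg_mul_sq (by norm_num) _).const_mul _

lemma integral (a : ℕ) : ∫ x, evenGauss a x = √(2 * Real.pi) * √(centralRatio a) := by
  simp only [eq_mul]
  rw [integral_const_mul, integral_even_pow_mul_exp_neg_mul_sq (by norm_num),
    show Real.pi / (1 / 2) = 2 * Real.pi by ring]
  have h1 : (2 * a).factorial = (4 ^ a * centralRatio a) * (a.factorial : ℝ) ^ 2 := by
    rw [centralRatio, Nat.centralBinom_eq_two_mul_choose]
    have := Nat.choose_mul_factorial_mul_factorial (show a ≤ 2 * a by omega)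
    rw [show 2 * a - a = a by omega] at this
    rw [← this]
    push_cast
    field_simp
  have hb := centralRatio.pos a
  rw [h1, Real.sqrt_mul (by positivity), Real.sqrt_sq (by positivity),
    Real.sqrt_mul (by positivity), show (4 : ℝ) ^ a = (2 ^ a) ^ 2 by rw [← pow_mul, mul_comm, pow_mul]; norm_num,
    Real.sqrt_sq (by positivity)]
  have hs : √(centralRatio a) ≠ 0 := by positivity
  field_simp
  rw [Real.sq_sqrt hb.le, one_div, inv_pow]
  field_simp

lemma hasSum (x y : ℝ) : HasSum (fun c => evenGauss c x * evenGauss c y)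
    (Real.exp (-x ^ 2 / 2) * Real.exp (-y ^ 2 / 2) * Real.cosh (x * y)) := by
  refine ((Real.hasSum_cosh (x * y)).mul_left _).congr_fun ?_
  intro c
  have : √((2 * c).factorial : ℝ) ^ 2 = (2 * c).factorial := Real.sq_sqrt (by positivity)
  unfold evenGauss
  field_simp
  rw [this, mul_pow]
  field_simp

end evenGauss

/-- Convolution of `evenGauss b` with the centred Gaussian law of variance `m`. -/
noncomputable def gaussConv (m b : ℕ) (y : ℝ) : ℝ≥0∞ :=
  ∫⁻ z, ENNReal.ofReal (evenGauss b (y + z)) ∂gaussianReal 0 m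

lemma lintegral_gaussianReal_of_ne_zero {v : ℝ≥0} (hv : v ≠ 0) {f : ℝ → ℝ≥0∞} (hf : Measurable f) :
    ∫⁻ z, f z ∂gaussianReal 0 v = ∫⁻ z, ENNReal.ofReal (gaussianPDFReal 0 v z) * f z := by
  rw [gaussianReal_of_var_ne_zero _ hv,
    lintegral_withDensity_eq_lintegral_mul _ (measurable_gaussianPDF 0 v) hf]
  rfl

lemma gaussianPDFReal_sub_add_gaussianPDFReal_add (x y : ℝ) :
    gaussianPDFReal 0 1 (x - y) + gaussianPDFReal 0 1 (x + y) =
      2 * (1 / √(2 * Real.pi)) * (Real.exp (-x ^ 2 / 2) * Real.exp (-y ^ 2 / 2) * Real.cosh (x * y)) := by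
  have e1 : Real.exp (-(x - y) ^ 2 / 2) =
      Real.exp (-x ^ 2 / 2) * Real.exp (-y ^ 2 / 2) * Real.exp (x * y) := by
    rw [← Real.exp_add, ← Real.exp_add]
    ring_nf
  have e2 : Real.exp (-(x + y) ^ 2 / 2) =
      Real.exp (-x ^ 2 / 2) * Real.exp (-y ^ 2 / 2) * Real.exp (-(x * y)) := by
    rw [← Real.exp_add, ← Real.exp_add]
    ring_nf
  simp only [gaussianPDFReal, sub_zero, NNReal.coe_one, mul_one]
  rw [e1, e2, Real.cosh_eq]
  ring

namespace gaussConv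

lemma zero (b : ℕ) (y : ℝ) : gaussConv 0 b y = ENNReal.ofReal (evenGauss b y) := by
  simp [gaussConv]

lemma one_eq_lintegral (b : ℕ) (y : ℝ) : gaussConv 1 b y =
    ∫⁻ x, ENNReal.ofReal (gaussianPDFReal 0 1 (x - y)) * ENNReal.ofReal (evenGauss b x) := by
  rw [gaussConv, lintegral_gaussianReal_of_ne_zero (by simp) (by fun_prop),
    ← lintegral_sub_right_eq_self _ y]
  simp

lemma one_eq_lintegral' (b : ℕ) (y : ℝ) : gaussConv 1 b y =
    ∫⁻ x, ENNReal.ofReal (gaussianPDFReal 0 1 (x + y)) * ENNReal.ofReal (evenGauss b x) := by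
  rw [one_eq_lintegral, ← lintegral_neg_eq_self]
  refine lintegral_congr fun x => ?_
  rw [evenGauss.neg]
  congr 2
  simp only [gaussianPDFReal]
  ring_nf

lemma one (b : ℕ) (y : ℝ) : gaussConv 1 b y =
    ∑' c, ENNReal.ofReal (evenGauss c y) * ENNReal.ofReal (ginibreEntry c b) := by
  have h2 : 2 * gaussConv 1 b y =
      2 * ∑' c, ENNReal.ofReal (evenGauss c y) * ENNReal.ofReal (ginibreEntry c b) := by
    have hm : Measurable fun x => ENNReal.ofReal (gaussianPDFReal 0 1 (x + y)) *
        ENNReal.ofReal (evenGauss b x) :=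
      ((measurable_gaussianPDFReal 0 1).comp (measurable_add_const y)).ennreal_ofReal.mul
        (by fun_prop)
    have hterm (x : ℝ) : ENNReal.ofReal (gaussianPDFReal 0 1 (x - y)) * ENNReal.ofReal (evenGauss b x) +
        ENNReal.ofReal (gaussianPDFReal 0 1 (x + y)) * ENNReal.ofReal (evenGauss b x) =
        ∑' c, 2 * ENNReal.ofReal (evenGauss c y) * (ENNReal.ofReal (1 / √(2 * Real.pi)) *
          (ENNReal.ofReal (evenGauss c x) * ENNReal.ofReal (evenGauss b x))) := by
      rw [← add_mul, ← ENNReal.ofReal_add (gaussianPDFReal_nonneg _ _ _) (gaussianPDFReal_nonneg _ _ _),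
        gaussianPDFReal_sub_add_gaussianPDFReal_add, ← (evenGauss.hasSum x y).tsum_eq,
        ENNReal.ofReal_mul (by positivity), ENNReal.ofReal_tsum_of_nonneg
          (fun c => mul_nonneg (evenGauss.nonneg _ _) (evenGauss.nonneg _ _))
          (evenGauss.hasSum x y).summable, ← ENNReal.tsum_mul_left, ← ENNReal.tsum_mul_right]
      refine tsum_congr fun c => ?_
      rw [ENNReal.ofReal_mul (evenGauss.nonneg _ _), ENNReal.ofReal_mul (by norm_num),
        ENNReal.ofReal_ofNat]
      ring
    calc 2 * gaussConv 1 b y = gaussConv 1 b y + gaussConv 1 b y := two_mul _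
      _ = ∫⁻ x, (ENNReal.ofReal (gaussianPDFReal 0 1 (x - y)) * ENNReal.ofReal (evenGauss b x) +
        ENNReal.ofReal (gaussianPDFReal 0 1 (x + y)) * ENNReal.ofReal (evenGauss b x)) := by
        rw [lintegral_add_right _ hm, ← one_eq_lintegral,
          ← one_eq_lintegral']
      _ = _ := by
        simp only [hterm]
        rw [lintegral_tsum fun c => by fun_prop, ← ENNReal.tsum_mul_left]
        refine tsum_congr fun c => ?_
        rw [lintegral_const_mul _ (by fun_prop), lintegral_const_mul _ (by fun_prop),
          evenGauss.lintegral_mul, mul_assoc]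
  exact (ENNReal.mul_right_inj two_ne_zero ENNReal.ofNat_ne_top).1 h2

lemma succ (m b : ℕ) (y : ℝ) :
    gaussConv (m + 1) b y = ∫⁻ z, gaussConv m b (y + z) ∂gaussianReal 0 1 := by
  have h := gaussianReal_conv_gaussianReal (m₁ := 0) (m₂ := 0) (v₁ := 1) (v₂ := m)
  rw [add_zero, add_comm (1 : ℝ≥0)] at h
  rw [gaussConv, Nat.cast_succ, ← h, Measure.lintegral_conv (by fun_prop)]
  simp only [gaussConv, add_assoc]

end gaussConv

/-- The powers of the infinite matrix `ginibreEntry`. -/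
noncomputable def ginibrePow : ℕ → ℕ → ℕ → ℝ≥0∞
  | 0, a, b => if a = b then 1 else 0
  | m + 1, a, b => ∑' c, ENNReal.ofReal (ginibreEntry a c) * ginibrePow m c b

lemma gaussConv_eq_tsum (m b : ℕ) (y : ℝ) :
    gaussConv m b y = ∑' c, ENNReal.ofReal (evenGauss c y) * ginibrePow m c b := by
  induction m generalizing y with
  | zero => simp [gaussConv.zero, ginibrePow]
  | succ m ih =>
    rw [gaussConv.succ]
    simp only [ih, ginibrePow]
    rw [lintegral_tsum fun c => by fun_prop]
    have h (c : ℕ) : ∫⁻ z, ENNReal.ofReal (evenGauss c (y + z)) * ginibrePow m c b ∂gaussianReal 0 1 =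
        ∑' d, ENNReal.ofReal (evenGauss d y) *
          (ENNReal.ofReal (ginibreEntry d c) * ginibrePow m c b) := by
      rw [lintegral_mul_const _ (by fun_prop)]
      have := gaussConv.one c y
      rw [gaussConv, Nat.cast_one] at this
      rw [this, ← ENNReal.tsum_mul_right]
      simp only [mul_assoc]
    simp only [h]
    rw [ENNReal.tsum_comm]
    simp only [ENNReal.tsum_mul_left]

lemma ginibrePow_succ_eq_lintegral (m a b : ℕ) : ginibrePow (m + 1) a b =
    ENNReal.ofReal (1 / √(2 * Real.pi)) *
      ∫⁻ y, ENNReal.ofReal (evenGauss a y) * gaussConv m b y := by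
  simp only [gaussConv_eq_tsum, ← ENNReal.tsum_mul_left]
  rw [lintegral_tsum fun c => by fun_prop, ← ENNReal.tsum_mul_left, ginibrePow]
  refine tsum_congr fun c => ?_
  rw [← evenGauss.lintegral_mul, mul_assoc, ← lintegral_mul_const _ (by fun_prop)]
  simp only [mul_assoc]

lemma ginibrePow_one (a b : ℕ) : ginibrePow 1 a b = ENNReal.ofReal (ginibreEntry a b) := by
  simp only [ginibrePow, mul_ite, mul_one, mul_zero]
  exact tsum_ite_eq b _

lemma lintegral_evenGauss (a : ℕ) : ∫⁻ x, ENNReal.ofReal (evenGauss a x) =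
    ENNReal.ofReal (√(2 * Real.pi) * √(centralRatio a)) := by
  rw [← ofReal_integral_eq_lintegral_ofReal (evenGauss.integrable a)
    (ae_of_all _ (evenGauss.nonneg a)), evenGauss.integral]

lemma gaussConv_le {m : ℕ} (hm : m ≠ 0) (b : ℕ) (y : ℝ) :
    gaussConv m b y ≤ ENNReal.ofReal (√(centralRatio b) / √m) := by
  have hm' : ((m : ℕ) : ℝ≥0) ≠ 0 := by exact_mod_cast hm
  have hle (z : ℝ) : gaussianPDFReal 0 m z ≤ 1 / √(2 * Real.pi * m) := by
    rw [gaussianPDFReal, NNReal.coe_natCast, one_div]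
    refine mul_le_of_le_one_right (by positivity) (Real.exp_le_one_iff.2 ?_)
    rw [neg_div]
    exact neg_nonpos.2 (by positivity)
  rw [gaussConv, lintegral_gaussianReal_of_ne_zero hm' (by fun_prop)]
  calc _ ≤ ∫⁻ z, ENNReal.ofReal (1 / √(2 * Real.pi * m)) * ENNReal.ofReal (evenGauss b (y + z)) :=
        lintegral_mono fun z => mul_le_mul_left (ENNReal.ofReal_le_ofReal (hle z)) _
    _ = _ := by
      rw [lintegral_const_mul _ (by fun_prop),
        lintegral_add_left_eq_self (fun z => ENNReal.ofReal (evenGauss b z)),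
        lintegral_evenGauss, ← ENNReal.ofReal_mul (by positivity)]
      congr 1
      rw [Real.sqrt_mul (by positivity)]
      field_simp

lemma ginibrePow_succ_le {m : ℕ} (hm : m ≠ 0) (a b : ℕ) :
    ginibrePow (m + 1) a b ≤ ENNReal.ofReal (√(centralRatio a) * √(centralRatio b) / √m) := by
  rw [ginibrePow_succ_eq_lintegral]
  calc _ ≤ ENNReal.ofReal (1 / √(2 * Real.pi)) * ∫⁻ y, ENNReal.ofReal (evenGauss a y) *
        ENNReal.ofReal (√(centralRatio b) / √m) := by
        gcongr with y
        exact gaussConv_le hm b y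
    _ = _ := by
      rw [lintegral_mul_const _ (by fun_prop), lintegral_evenGauss,
        ← ENNReal.ofReal_mul (by positivity), ← ENNReal.ofReal_mul (by positivity)]
      congr 1
      field_simp

lemma ginibreEntry_nonneg (a b : ℕ) : 0 ≤ ginibreEntry a b := by
  rw [← evenGauss.integral_mul]
  exact mul_nonneg (by positivity) (integral_nonneg fun x =>
    mul_nonneg (evenGauss.nonneg _ _) (evenGauss.nonneg _ _))

lemma ginibreEntry_comm (a b : ℕ) : ginibreEntry a b = ginibreEntry b a := by
  rw [ginibreEntry, ginibreEntry, add_comm (a : ℝ), mul_comm ((2 * a).factorial : ℝ)]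

lemma ginibreEntry_self (a : ℕ) : ginibreEntry a a = centralRatio (2 * a) / √2 := by
  rw [ginibreEntry, Real.sqrt_mul_self (by positivity),
    show (a : ℝ) + a + 1 / 2 = (2 * a : ℕ) + 1 / 2 by push_cast; ring, centralRatio.gamma_add_half,
    Real.sqrt_mul (by positivity)]
  have : √Real.pi ≠ 0 := by positivity
  field_simp

lemma ginibreEntry_self_le (a : ℕ) : ginibreEntry a a ≤ centralRatio a := by
  rw [ginibreEntry_self]
  have h1 : (1 : ℝ) ≤ √2 := Real.one_le_sqrt.2 (by norm_num)
  exact (div_le_self (centralRatio.pos _).le h1).trans (centralRatio.antitone (by omega))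

lemma ginibreEntry_le_one (a b : ℕ) : ginibreEntry a b ≤ 1 := by
  have h : ginibreEntry a b ≤ (ginibreEntry a a + ginibreEntry b b) / 2 := by
    simp only [← evenGauss.integral_mul]
    rw [← mul_add, mul_div_assoc]
    refine mul_le_mul_of_nonneg_left ?_ (by positivity)
    rw [← integral_add (evenGauss.integrable_mul _ _) (evenGauss.integrable_mul _ _),
      ← integral_div]
    refine integral_mono (evenGauss.integrable_mul _ _)
      (((evenGauss.integrable_mul _ _).add (evenGauss.integrable_mul _ _)).div_const _) fun x => ?_
    nlinarith [sq_nonneg (evenGauss a x - evenGauss b x)]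
  have ha := (ginibreEntry_self_le a).trans (centralRatio.le_one a)
  have hb := (ginibreEntry_self_le b).trans (centralRatio.le_one b)
  linarith

lemma ginibrePow_le_one (m a b : ℕ) : ginibrePow m a b ≤ 1 := by
  match m with
  | 0 =>
    simp only [ginibrePow]
    split_ifs <;> simp
  | 1 =>
    rw [ginibrePow_one]
    exact ENNReal.ofReal_le_one.2 (ginibreEntry_le_one a b)
  | m + 2 =>
    refine (ginibrePow_succ_le (Nat.succ_ne_zero m) a b).trans (ENNReal.ofReal_le_one.2 ?_)
    rw [div_le_one (by positivity)]
    have h1 : √(centralRatio a) * √(centralRatio b) ≤ 1 :=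
      mul_le_one₀ (Real.sqrt_le_one.2 (centralRatio.le_one a)) (Real.sqrt_nonneg _)
        (Real.sqrt_le_one.2 (centralRatio.le_one b))
    refine h1.trans (Real.one_le_sqrt.2 ?_)
    push_cast
    linarith [(Nat.cast_nonneg m : (0 : ℝ) ≤ m)]

lemma ginibrePow_ne_top (m a b : ℕ) : ginibrePow m a b ≠ ∞ :=
  ne_top_of_le_ne_top ENNReal.one_ne_top (ginibrePow_le_one m a b)

lemma ginibrePow_self_le {m : ℕ} (hm : m ≠ 0) (a : ℕ) :
    ginibrePow m a a ≤ ENNReal.ofReal (2 / √m * (1 / √(a + 1))) := by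
  match m with
  | 1 =>
    rw [ginibrePow_one]
    refine ENNReal.ofReal_le_ofReal ?_
    have h1 := (ginibreEntry_self_le a).trans (centralRatio.le_inv_sqrt a)
    have h2 := (ginibreEntry_nonneg a a).trans h1
    simp only [Nat.cast_one, Real.sqrt_one, div_one]
    linarith
  | m + 2 =>
    refine (ginibrePow_succ_le (Nat.succ_ne_zero m) a a).trans (ENNReal.ofReal_le_ofReal ?_)
    rw [Real.mul_self_sqrt (centralRatio.pos a).le, mul_comm (2 / _), mul_div_assoc',
      div_eq_mul_inv, div_eq_mul_inv]
    have h : (√((m + 1 : ℕ) : ℝ))⁻¹ ≤ 2 * (√((m + 2 : ℕ) : ℝ))⁻¹ := by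
      rw [← div_eq_mul_inv, inv_eq_one_div, div_le_div_iff₀ (by positivity) (by positivity), one_mul,
        Real.sqrt_le_iff]
      refine ⟨by positivity, ?_⟩
      rw [mul_pow, Real.sq_sqrt (by positivity)]
      push_cast
      linarith [(Nat.cast_nonneg m : (0 : ℝ) ≤ m)]
    rw [mul_assoc]
    exact mul_le_mul (centralRatio.le_inv_sqrt a) h (by positivity) (by positivity)

lemma integrable_half_pow_mul_exp (m j : ℕ) :
    Integrable (fun z : ℝ => (z / 2) ^ (2 * j) * Real.exp (-(z / 2) ^ 2)) (gaussianReal 0 m) := by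
  refine Integrable.of_bound (C := j.factorial) (by fun_prop) (ae_of_all _ fun z => ?_)
  have h0 : 0 ≤ (z / 2) ^ 2 := sq_nonneg _
  rw [pow_mul, Real.norm_of_nonneg (by positivity), Real.exp_neg, ← div_eq_mul_inv,
    div_le_iff₀ (Real.exp_pos _), ← div_le_iff₀' (by positivity)]
  exact Real.pow_div_factorial_le_exp _ h0 j

lemma integral_half_pow_mul_exp (m j : ℕ) :
    ∫ z : ℝ, (z / 2) ^ (2 * j) * Real.exp (-(z / 2) ^ 2) ∂gaussianReal 0 m =
      √(2 / (m + 2)) * (j.factorial * centralRatio j * ((m : ℝ) / (m + 2)) ^ j) := by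
  rcases Nat.eq_zero_or_pos m with rfl | hm
  · rcases Nat.eq_zero_or_pos j with rfl | hj
    · simp [centralRatio.zero]
    · simp [hj.ne']
  · have hm' : ((m : ℕ) : ℝ≥0) ≠ 0 := by exact_mod_cast hm.ne'
    have hm0 : (0 : ℝ) < m := by exact_mod_cast hm
    have hβ : 0 < ((m : ℝ) + 2) / (4 * m) := by positivity
    rw [integral_gaussianReal_eq_integral_smul hm']
    have h (z : ℝ) : gaussianPDFReal 0 m z • ((z / 2) ^ (2 * j) * Real.exp (-(z / 2) ^ 2)) =
        ((√(2 * Real.pi * m))⁻¹ * (1 / 4 ^ j)) *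
          (z ^ (2 * j) * Real.exp (-(((m : ℝ) + 2) / (4 * m)) * z ^ 2)) := by
      have e : Real.exp (-(((m : ℝ) + 2) / (4 * m)) * z ^ 2) =
          Real.exp (-(z - 0) ^ 2 / (2 * m)) * Real.exp (-(z / 2) ^ 2) := by
        rw [← Real.exp_add]
        congr 1
        field_simp
        ring
      rw [e, gaussianPDFReal, NNReal.coe_natCast, smul_eq_mul, div_pow, pow_mul 2, 
        show (2 : ℝ) ^ 2 = 4 by norm_num]
      ring
    simp only [h]
    rw [integral_const_mul, integral_even_pow_mul_exp_neg_mul_sq hβ]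
    have e1 : √(Real.pi / (((m : ℝ) + 2) / (4 * m))) = √(2 * Real.pi * m) * √(2 / (m + 2)) := by
      rw [← Real.sqrt_mul (by positivity)]
      congr 1
      field_simp
      ring
    have h2 : √(2 * Real.pi * m) ≠ 0 := by positivity
    rw [e1, div_pow, div_pow, mul_pow]
    field_simp

lemma evenGauss_mul_shift (a : ℕ) (y h : ℝ) : evenGauss a (y - h) * evenGauss a (y + h) =
    ∑ j ∈ Finset.range (2 * a + 1), (h ^ (2 * j) * Real.exp (-h ^ 2)) *
      ((-1) ^ j / (j.factorial * (2 * a - j).factorial)) *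
        (y ^ (2 * (2 * a - j)) * Real.exp (-1 * y ^ 2)) := by
  have e : Real.exp (-(y - h) ^ 2 / 2) * Real.exp (-(y + h) ^ 2 / 2) =
      Real.exp (-h ^ 2) * Real.exp (-1 * y ^ 2) := by
    rw [← Real.exp_add, ← Real.exp_add]
    ring_nf
  have e2 : (y - h) ^ (2 * a) * (y + h) ^ (2 * a) = (-h ^ 2 + y ^ 2) ^ (2 * a) := by
    rw [← mul_pow]
    ring_nf
  have hs : √((2 * a).factorial : ℝ) * √((2 * a).factorial : ℝ) = (2 * a).factorial :=
    Real.mul_self_sqrt (by positivity)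
  calc _ = ((y - h) ^ (2 * a) * (y + h) ^ (2 * a)) * (Real.exp (-(y - h) ^ 2 / 2) *
        Real.exp (-(y + h) ^ 2 / 2)) / (√((2 * a).factorial : ℝ) * √((2 * a).factorial : ℝ)) := by
        unfold evenGauss
        ring
    _ = _ := by
      rw [e, e2, hs, add_pow, Finset.sum_mul, Finset.sum_div]
      refine Finset.sum_congr rfl fun j hj => ?_
      have hj' : j ≤ 2 * a := Nat.lt_succ_iff.1 (Finset.mem_range.1 hj)
      rw [Nat.cast_choose ℝ hj', neg_pow, pow_mul h, pow_mul y]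
      field_simp

lemma ginibrePow_succ_self (m a : ℕ) : ginibrePow (m + 1) a a =
    ENNReal.ofReal (1 / √(m + 2) * twistedRatio ((m : ℝ) / (m + 2)) (2 * a)) := by
  have hreal (z : ℝ) : ∫ y, evenGauss a (y - z / 2) * evenGauss a (y + z / 2) =
      ∑ j ∈ Finset.range (2 * a + 1), ((z / 2) ^ (2 * j) * Real.exp (-(z / 2) ^ 2)) *
        ((-1) ^ j / j.factorial * (√Real.pi * centralRatio (2 * a - j))) := by
    have hint (j : ℕ) : Integrable fun y : ℝ => ((z / 2) ^ (2 * j) * Real.exp (-(z / 2) ^ 2)) *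
      ((-1) ^ j / (j.factorial * (2 * a - j).factorial)) *
        (y ^ (2 * (2 * a - j)) * Real.exp (-1 * y ^ 2)) :=
      (integrable_pow_mul_exp_neg_mul_sq one_pos _).const_mul _
    simp only [evenGauss_mul_shift]
    rw [integral_finsetSum _ fun j _ => hint j]
    refine Finset.sum_congr rfl fun j _ => ?_
    rw [integral_const_mul, integral_even_pow_mul_exp_neg_mul_sq one_pos, div_one, one_pow, div_one]
    field_simp
  have hnn (z : ℝ) : 0 ≤ ∑ j ∈ Finset.range (2 * a + 1),
      ((z / 2) ^ (2 * j) * Real.exp (-(z / 2) ^ 2)) *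
        ((-1) ^ j / j.factorial * (√Real.pi * centralRatio (2 * a - j))) :=
    hreal z ▸ integral_nonneg fun y => mul_nonneg (evenGauss.nonneg _ _) (evenGauss.nonneg _ _)
  have hinner (z : ℝ) : ∫⁻ y, ENNReal.ofReal (evenGauss a y) * ENNReal.ofReal (evenGauss a (y + z)) =
      ENNReal.ofReal (∑ j ∈ Finset.range (2 * a + 1),
        ((z / 2) ^ (2 * j) * Real.exp (-(z / 2) ^ 2)) *
          ((-1) ^ j / j.factorial * (√Real.pi * centralRatio (2 * a - j)))) := by
    rw [← lintegral_sub_right_eq_self _ (z / 2), ← hreal]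
    have h1 (y : ℝ) : ENNReal.ofReal (evenGauss a (y - z / 2)) *
        ENNReal.ofReal (evenGauss a (y - z / 2 + z)) =
        ENNReal.ofReal (evenGauss a (y - z / 2) * evenGauss a (y + z / 2)) := by
      rw [ENNReal.ofReal_mul (evenGauss.nonneg _ _)]
      congr 3
      ring
    simp only [h1]
    rw [← ofReal_integral_eq_lintegral_ofReal]
    · simp only [evenGauss_mul_shift]
      exact integrable_finsetSum _ fun j _ =>
        (integrable_pow_mul_exp_neg_mul_sq one_pos _).const_mul _
    · exact ae_of_all _ fun y => mul_nonneg (evenGauss.nonneg _ _) (evenGauss.nonneg _ _)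
  rw [ginibrePow_succ_eq_lintegral]
  simp only [gaussConv]
  have h2 : ∫⁻ y, ENNReal.ofReal (evenGauss a y) *
      ∫⁻ z, ENNReal.ofReal (evenGauss a (y + z)) ∂gaussianReal 0 m =
      ∫⁻ z, (∫⁻ y, ENNReal.ofReal (evenGauss a y) * ENNReal.ofReal (evenGauss a (y + z)))
        ∂gaussianReal 0 m := by
    rw [← lintegral_lintegral_swap (by fun_prop)]
    refine lintegral_congr fun y => ?_
    rw [lintegral_const_mul _ (by fun_prop)]
  rw [h2]
  simp only [hinner]
  rw [← ofReal_integral_eq_lintegral_ofReal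
    (integrable_finsetSum _ fun j _ => (integrable_half_pow_mul_exp m j).mul_const _)
    (ae_of_all _ hnn),
    integral_finsetSum _ fun j _ => (integrable_half_pow_mul_exp m j).mul_const _,
    ← ENNReal.ofReal_mul (by positivity)]
  congr 1
  rw [twistedRatio, Finset.mul_sum, Finset.mul_sum]
  refine Finset.sum_congr rfl fun j _ => ?_
  rw [integral_mul_const, integral_half_pow_mul_exp, neg_pow (_ / _), Real.sqrt_mul (by positivity),
    Real.sqrt_div (by positivity)]
  have : √Real.pi ≠ 0 := by positivity
  field_simp

/-- The trace of the `n × n` upper left corner of the `m`-th power of the infinite matrix. -/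
noncomputable def cornerTrace (m n : ℕ) : ℝ :=
  ∑ a ∈ Finset.range n, (ginibrePow m a a).toReal

lemma tendsto_cornerTrace (m : ℕ) :
    Tendsto (fun n : ℕ => cornerTrace (m + 1) n / √(2 * n)) atTop
      (𝓝 (1 / √(2 * Real.pi * (m + 1)))) := by
  refine tendsto_sum_div_sqrt ?_
  have h0 : (0 : ℝ) ≤ (m : ℝ) / (m + 2) := by positivity
  have h1 : (m : ℝ) / (m + 2) < 1 := by
    rw [div_lt_one (by positivity)]
    linarith
  have h2 : Tendsto (fun n : ℕ => 2 * n) atTop atTop :=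
    tendsto_id.const_mul_atTop' (by norm_num)
  have h := (((tendsto_sqrt_mul_twistedRatio h0 h1).comp h2).const_mul (1 / √((m : ℝ) + 2))).max
    (tendsto_const_nhds (x := (0 : ℝ)))
  have e : max (1 / √((m : ℝ) + 2) * (1 / √Real.pi * (1 / √(1 + (m : ℝ) / (m + 2))))) 0 =
      1 / √(2 * Real.pi * (m + 1)) := by
    rw [max_eq_left (by positivity), show 1 + (m : ℝ) / (m + 2) = 2 * (m + 1) / (m + 2) by
      field_simp; ring, Real.sqrt_div (by positivity), Real.sqrt_mul (by positivity),
      Real.sqrt_mul (by positivity), Real.sqrt_mul (by positivity)]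
    have : √((m : ℝ) + 2) ≠ 0 := by positivity
    field_simp
  rw [e] at h
  refine h.congr fun n => ?_
  simp only [Function.comp_apply]
  rw [ginibrePow_succ_self, ENNReal.toReal_ofReal', mul_max_of_nonneg _ _ (Real.sqrt_nonneg _),
    mul_zero]
  push_cast
  congr 1
  ring

lemma sum_one_div_sqrt_le (n : ℕ) : ∑ a ∈ Finset.range n, 1 / √((a : ℝ) + 1) ≤ 2 * √n := by
  induction n with
  | zero => simp
  | succ n ih =>
    rw [Finset.sum_range_succ]
    have h1 : 0 < √((n : ℝ) + 1) := by positivity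
    have h2 : √(n : ℝ) ≤ √((n : ℝ) + 1) := Real.sqrt_le_sqrt (by linarith)
    have e1 : √(n : ℝ) ^ 2 = n := Real.sq_sqrt (by positivity)
    have e2 : √((n : ℝ) + 1) ^ 2 = n + 1 := Real.sq_sqrt (by positivity)
    have h3 : 1 / √((n : ℝ) + 1) ≤ 2 * (√((n : ℝ) + 1) - √n) := by
      rw [div_le_iff₀ h1]
      nlinarith [Real.sqrt_nonneg (n : ℝ), sq_nonneg (√((n : ℝ) + 1) - √n)]
    push_cast
    linarith

lemma cornerTrace_le {m : ℕ} (hm : m ≠ 0) (n : ℕ) : cornerTrace m n ≤ 4 * √n / √m := by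
  have h (a : ℕ) : (ginibrePow m a a).toReal ≤ 2 / √m * (1 / √((a : ℝ) + 1)) :=
    ENNReal.toReal_le_of_le_ofReal (by positivity) (ginibrePow_self_le hm a)
  calc cornerTrace m n ≤ ∑ a ∈ Finset.range n, 2 / √m * (1 / √((a : ℝ) + 1)) :=
        Finset.sum_le_sum fun a _ => h a
    _ = 2 / √m * ∑ a ∈ Finset.range n, 1 / √((a : ℝ) + 1) := by rw [Finset.mul_sum]
    _ ≤ 2 / √m * (2 * √n) := by gcongr; exact sum_one_div_sqrt_le n
    _ = 4 * √n / √m := by ring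

lemma ginibrePow_add (i j a b : ℕ) :
    ginibrePow (i + j) a b = ∑' c, ginibrePow i a c * ginibrePow j c b := by
  induction i generalizing a with
  | zero =>
    simp only [zero_add, ginibrePow, ite_mul, one_mul, zero_mul]
    exact (tsum_ite_eq' a fun c => ginibrePow j c b).symm
  | succ i ih =>
    rw [Nat.add_right_comm]
    simp only [ginibrePow, ih, ← ENNReal.tsum_mul_left, ← ENNReal.tsum_mul_right]
    rw [ENNReal.tsum_comm]
    simp only [mul_assoc]

lemma ginibreM_pow_nonneg (n m : ℕ) (i j : Fin n) : 0 ≤ (ginibreM n ^ m) i j := by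
  induction m generalizing i j with
  | zero =>
    rw [pow_zero, Matrix.one_apply]
    split_ifs <;> norm_num
  | succ m ih =>
    rw [pow_succ, Matrix.mul_apply]
    exact Finset.sum_nonneg fun c _ => mul_nonneg (ih _ _)
      (ginibreM_apply n c j ▸ ginibreEntry_nonneg _ _)

lemma ofReal_ginibreM_pow_succ (n m : ℕ) (i j : Fin n) :
    ENNReal.ofReal ((ginibreM n ^ (m + 1)) i j) = ∑ c, ENNReal.ofReal ((ginibreM n ^ m) i c) *
      ENNReal.ofReal (ginibreEntry c j) := by
  rw [pow_succ, Matrix.mul_apply, ENNReal.ofReal_sum_of_nonneg]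
  · simp only [ginibreM_apply, ENNReal.ofReal_mul (ginibreM_pow_nonneg n m i _)]
  · exact fun c _ => mul_nonneg (ginibreM_pow_nonneg _ _ _ _)
      (ginibreM_apply n c j ▸ ginibreEntry_nonneg _ _)

lemma sum_fin_le_tsum (n : ℕ) (f : ℕ → ℝ≥0∞) : ∑ c : Fin n, f c ≤ ∑' c, f c := by
  rw [Fin.sum_univ_eq_sum_range]
  exact ENNReal.sum_le_tsum _

lemma ofReal_ginibreM_pow_le (n m : ℕ) (i j : Fin n) :
    ENNReal.ofReal ((ginibreM n ^ m) i j) ≤ ginibrePow m i j := by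
  induction m generalizing j with
  | zero =>
    rw [pow_zero, Matrix.one_apply, ginibrePow]
    simp only [Fin.ext_iff]
    split_ifs <;> simp
  | succ m ih =>
    rw [ofReal_ginibreM_pow_succ, ginibrePow_add]
    refine le_trans (Finset.sum_le_sum fun c _ => ?_)
      (sum_fin_le_tsum n fun c => ginibrePow m i c * ginibrePow 1 c j)
    rw [ginibrePow_one]
    gcongr
    exact ih c

lemma trace_ginibreM_pow_le (n m : ℕ) : (ginibreM n ^ m).trace ≤ cornerTrace m n := by
  rw [Matrix.trace, cornerTrace,
    ← Fin.sum_univ_eq_sum_range (fun a => (ginibrePow m a a).toReal) n]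
  refine Finset.sum_le_sum fun i _ => ?_
  rw [Matrix.diag_apply, ← ENNReal.toReal_ofReal (ginibreM_pow_nonneg n m i i)]
  exact ENNReal.toReal_mono (ginibrePow_ne_top _ _ _) (ofReal_ginibreM_pow_le n m i i)

/-- The contribution to the corner trace of the paths whose first step leaves `{0, …, n - 1}`. -/
noncomputable def cornerLeak (k n : ℕ) : ℝ≥0∞ :=
  ∑ b : Fin n, ∑' c, ENNReal.ofReal (ginibreEntry b (c + n)) * ginibrePow k (c + n) b

lemma sum_pow_mul_ginibrePow_succ_le (n i j : ℕ) :
    ∑ a : Fin n, ∑ b : Fin n, ENNReal.ofReal ((ginibreM n ^ i) a b) * ginibrePow (j + 1) b a ≤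
      (∑ a : Fin n, ∑ b : Fin n, ENNReal.ofReal ((ginibreM n ^ (i + 1)) a b) * ginibrePow j b a) +
        cornerLeak (j + i) n := by
  have hsplit (b a : Fin n) : ginibrePow (j + 1) b a =
      (∑ c : Fin n, ENNReal.ofReal (ginibreEntry b c) * ginibrePow j c a) +
        ∑' c, ENNReal.ofReal (ginibreEntry b (c + n)) * ginibrePow j (c + n) a := by
    rw [ginibrePow, Fin.sum_univ_eq_sum_range
      (fun c => ENNReal.ofReal (ginibreEntry b c) * ginibrePow j c a)]
    exact (ENNReal.summable.sum_add_tsum_nat_add' (k := n)).symm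
  simp only [hsplit, mul_add, Finset.sum_add_distrib]
  refine add_le_add (le_of_eq ?_) ?_
  · refine Finset.sum_congr rfl fun a _ => ?_
    simp only [ofReal_ginibreM_pow_succ, Finset.mul_sum, Finset.sum_mul]
    rw [Finset.sum_comm]
    simp only [mul_assoc]
  · rw [Finset.sum_comm, cornerLeak]
    refine Finset.sum_le_sum fun b _ => ?_
    simp only [← ENNReal.tsum_mul_left]
    rw [← Summable.tsum_finsetSum fun _ _ => ENNReal.summable]
    refine ENNReal.tsum_le_tsum fun c => ?_
    rw [ginibrePow_add]
    calc _ = ENNReal.ofReal (ginibreEntry b (c + n)) * ∑ a : Fin n,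
          ginibrePow j (c + n) a * ENNReal.ofReal ((ginibreM n ^ i) a b) := by
          rw [Finset.mul_sum]
          exact Finset.sum_congr rfl fun a _ => by ring
      _ ≤ _ := by
          gcongr
          refine le_trans (Finset.sum_le_sum fun a _ => ?_)
            (sum_fin_le_tsum n fun a => ginibrePow j (c + n) a * ginibrePow i a b)
          gcongr
          exact ofReal_ginibreM_pow_le n i a b

lemma sum_ginibrePow_self_le (n m : ℕ) : ∑ a : Fin n, ginibrePow (m + 1) a a ≤
    (∑ a : Fin n, ENNReal.ofReal ((ginibreM n ^ (m + 1)) a a)) + (m + 1) * cornerLeak m n := by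
  have h (i : ℕ) (hi : i ≤ m + 1) : ∑ a : Fin n, ginibrePow (m + 1) a a ≤
      (∑ a : Fin n, ∑ b : Fin n, ENNReal.ofReal ((ginibreM n ^ i) a b) *
        ginibrePow (m + 1 - i) b a) + i * cornerLeak m n := by
    induction i with
    | zero => simp [Matrix.one_apply, apply_ite ENNReal.ofReal, ite_mul]
    | succ i ih =>
      refine (ih (by omega)).trans ?_
      have := sum_pow_mul_ginibrePow_succ_le n i (m - i)
      rw [show m - i + 1 = m + 1 - i by omega, show m - i + i = m by omega] at this
      rw [show m + 1 - (i + 1) = m - i by omega]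
      push_cast
      calc _ ≤ _ := add_le_add_left this _
        _ = _ := by ring
  refine (h (m + 1) le_rfl).trans (le_of_eq ?_)
  simp [ginibrePow, Fin.ext_iff.symm]

lemma ginibreEntry_succ_le (b c : ℕ) :
    ginibreEntry b (c + 1) ≤ ginibreEntry b c * ((b + c + 1 / 2) / (2 * c + 1)) := by
  have hf : ((2 * (c + 1)).factorial : ℝ) = (2 * c + 2) * (2 * c + 1) * (2 * c).factorial := by
    rw [show 2 * (c + 1) = 2 * c + 1 + 1 by ring, Nat.factorial_succ, Nat.factorial_succ]
    push_cast
    ring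
  have hle : (2 * c + 1) * √((2 * b).factorial * (2 * c).factorial) ≤
      √((2 * b).factorial * (2 * (c + 1)).factorial : ℝ) := by
    refine Real.le_sqrt_of_sq_le ?_
    rw [mul_pow, Real.sq_sqrt (by positivity), hf]
    have : (0 : ℝ) ≤ (2 * b).factorial * (2 * c).factorial * (2 * c + 1) := by positivity
    nlinarith
  rw [ginibreEntry, ginibreEntry, Nat.cast_succ,
    show (b : ℝ) + (c + 1) + 1 / 2 = b + c + 1 / 2 + 1 by ring, Real.Gamma_add_one (by positivity)]
  have hG : 0 < Real.Gamma ((b : ℝ) + c + 1 / 2) := Real.Gamma_pos_of_pos (by positivity)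
  calc _ ≤ 1 / √(2 * Real.pi) * (((b : ℝ) + c + 1 / 2) * Real.Gamma (b + c + 1 / 2)) /
        ((2 * c + 1) * √((2 * b).factorial * (2 * c).factorial)) := by
        gcongr
    _ = _ := by
        field_simp

lemma ginibreEntry_le_pow {n L b : ℕ} (hb : b + 2 * L ≤ n) (d : ℕ) :
    ginibreEntry b (n - L + d) ≤ (1 - (L : ℝ) / (2 * n)) ^ d := by
  have hLn : (L : ℝ) ≤ n := by exact_mod_cast (by omega : L ≤ n)
  have hbn : (b : ℝ) + 2 * L ≤ n := by exact_mod_cast hb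
  have hr : (0 : ℝ) ≤ 1 - (L : ℝ) / (2 * n) := by
    rw [sub_nonneg]
    exact div_le_one_of_le₀ (by linarith [n.cast_nonneg (α := ℝ)]) (by positivity)
  induction d with
  | zero => simpa using ginibreEntry_le_one _ _
  | succ d ih =>
    rw [← add_assoc, pow_succ]
    refine (ginibreEntry_succ_le b (n - L + d)).trans
      (mul_le_mul ih ?_ (by positivity) (by positivity))
    rcases Nat.eq_zero_or_pos n with rfl | hn
    · obtain rfl : b = 0 := by omega
      simp only [CharP.cast_eq_zero, zero_add, mul_zero, div_zero, sub_zero]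
      exact div_le_one_of_le₀ (by linarith [(0 - L + d).cast_nonneg (α := ℝ)]) (by positivity)
    · have hn' : (0 : ℝ) < n := by exact_mod_cast hn
      have hc : ((n - L + d : ℕ) : ℝ) = n - L + d := by
        rw [Nat.cast_add, Nat.cast_sub (by omega)]
      have hd : (0 : ℝ) ≤ d := d.cast_nonneg
      have hb0 : (0 : ℝ) ≤ b := b.cast_nonneg
      have hL0 : (0 : ℝ) ≤ L := L.cast_nonneg
      rw [hc, one_sub_div (by positivity), div_le_div_iff₀ (by linarith) (by positivity)]
      nlinarith [mul_nonneg hd (sub_nonneg.2 hLn), mul_nonneg hn'.le (sub_nonneg.2 hbn)]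

lemma tsum_ginibreEntry_le {n L b : ℕ} (hb : b + 2 * L ≤ n) (hL : 0 < L) :
    ∑' c, ENNReal.ofReal (ginibreEntry b (c + n)) ≤
      ENNReal.ofReal ((1 - (L : ℝ) / (2 * n)) ^ L * (2 * n / L)) := by
  have hL' : (0 : ℝ) < L := by exact_mod_cast hL
  have hn' : (0 : ℝ) < n := by exact_mod_cast (by omega : 0 < n)
  have hLn : (L : ℝ) ≤ n := by exact_mod_cast (by omega : L ≤ n)
  set r : ℝ := 1 - (L : ℝ) / (2 * n) with hr
  have hr0 : 0 ≤ r := by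
    rw [hr, sub_nonneg]
    exact div_le_one_of_le₀ (by linarith) (by positivity)
  have hr1 : r < 1 := by
    rw [hr, sub_lt_self_iff]
    positivity
  have hs : HasSum (fun c : ℕ => r ^ L * r ^ c) (r ^ L * (2 * n / L)) := by
    have := (hasSum_geometric_of_lt_one hr0 hr1).mul_left (r ^ L)
    rwa [hr, sub_sub_cancel, inv_div, ← hr] at this
  rw [← hs.tsum_eq, ENNReal.ofReal_tsum_of_nonneg (fun c => by positivity) hs.summable]
  refine ENNReal.tsum_le_tsum fun c => ENNReal.ofReal_le_ofReal ?_
  rw [← pow_add, show c + n = n - L + (L + c) by omega]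
  exact ginibreEntry_le_pow hb _

lemma cornerLeak_le {n L : ℕ} (k : ℕ) (h : 4 * L ≤ n) (hL : 0 < L) :
    cornerLeak k n ≤ ENNReal.ofReal (n * ((1 - (L : ℝ) / (2 * n)) ^ L * (2 * n / L)) +
      2 * L * (2 * (1 / √(n / 2)))) := by
  have hn' : (0 : ℝ) < n := by exact_mod_cast (by omega : 0 < n)
  set f : ℕ → ℝ≥0∞ := fun b =>
    ∑' c, ENNReal.ofReal (ginibreEntry b (c + n)) * ginibrePow k (c + n) b with hf
  have hlow (b : ℕ) (hb : b ∈ Finset.range (n - 2 * L)) : f b ≤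
      ENNReal.ofReal ((1 - (L : ℝ) / (2 * n)) ^ L * (2 * n / L)) := by
    refine le_trans (ENNReal.tsum_le_tsum fun c => ?_)
      (tsum_ginibreEntry_le (b := b) (by have := Finset.mem_range.1 hb; omega) hL)
    exact mul_le_of_le_one_right' (ginibrePow_le_one _ _ _)
  have hhigh (b : ℕ) (hb : b ∈ Finset.Ico (n - 2 * L) n) : f b ≤
      ENNReal.ofReal (2 * (1 / √(n / 2))) := by
    have h1 : f b ≤ ginibrePow (k + 1) b b := by
      rw [ginibrePow]
      exact ENNReal.tsum_comp_le_tsum_of_injective (add_left_injective n)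
        (fun c => ENNReal.ofReal (ginibreEntry b c) * ginibrePow k c b)
    refine h1.trans ((ginibrePow_self_le k.succ_ne_zero b).trans (ENNReal.ofReal_le_ofReal ?_))
    have h2 : (n : ℝ) / 2 ≤ b + 1 := by
      have : n ≤ 2 * (b + 1) := by have := (Finset.mem_Ico.1 hb).1; omega
      have : (n : ℝ) ≤ 2 * (b + 1) := by exact_mod_cast this
      linarith
    have h3 : (1 : ℝ) ≤ √((k + 1 : ℕ) : ℝ) := Real.one_le_sqrt.2 (by simp)
    gcongr
    exact div_le_self (by norm_num) h3
  have hsum : cornerLeak k n = (∑ b ∈ Finset.range (n - 2 * L), f b) +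
      ∑ b ∈ Finset.Ico (n - 2 * L) n, f b := by
    rw [Finset.sum_range_add_sum_Ico _ (by omega), cornerLeak, ← Fin.sum_univ_eq_sum_range f n]
  have hr0 : 0 ≤ 1 - (L : ℝ) / (2 * n) := by
    rw [sub_nonneg]
    refine div_le_one_of_le₀ ?_ (by positivity)
    exact_mod_cast (by omega : L ≤ 2 * n)
  rw [hsum, ENNReal.ofReal_add (by positivity) (by positivity)]
  refine add_le_add ?_ ?_
  · refine (Finset.sum_le_card_nsmul _ _ _ hlow).trans ?_
    rw [Finset.card_range, nsmul_eq_mul, ENNReal.ofReal_mul n.cast_nonneg, ENNReal.ofReal_natCast]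
    gcongr
    omega
  · refine (Finset.sum_le_card_nsmul _ _ _ hhigh).trans (le_of_eq ?_)
    rw [Nat.card_Ico, show n - (n - 2 * L) = 2 * L by omega, nsmul_eq_mul,
      ← ENNReal.ofReal_natCast, ← ENNReal.ofReal_mul (by positivity)]
    push_cast
    rfl

lemma cornerLeak_eventually_le (k : ℕ) {ε : ℝ} (hε : 0 < ε) :
    ∀ᶠ n : ℕ in atTop, cornerLeak k n ≤ ENNReal.ofReal (ε * √(2 * n)) := by
  obtain ⟨q, hq⟩ := exists_nat_gt (max 4 (8 / ε))
  have hq4 : 4 < q := by exact_mod_cast (le_max_left _ _).trans_lt hq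
  have hqε : 8 / ε < q := (le_max_right _ _).trans_lt hq
  have hq0 : (0 : ℝ) < q := by exact_mod_cast (by omega : 0 < q)
  set r : ℝ := 1 - 1 / (4 * q) with hr
  have hr0 : 0 ≤ r := by
    rw [hr, sub_nonneg]
    refine div_le_one_of_le₀ ?_ (by positivity)
    exact_mod_cast (by omega : 1 ≤ 4 * q)
  have hr1 : r < 1 := by
    rw [hr, sub_lt_self_iff]
    positivity
  have hdiv : Tendsto (fun n : ℕ => n / q) atTop atTop := Nat.tendsto_div_const_atTop (by omega)
  have hlim : Tendsto (fun n : ℕ => 8 * q ^ 2 * (((n / q : ℕ) : ℝ) * r ^ (n / q))) atTop (𝓝 0) := by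
    simpa using ((tendsto_self_mul_const_pow_of_lt_one hr0 hr1).comp hdiv).const_mul
      (8 * (q : ℝ) ^ 2)
  filter_upwards [hlim.eventually_le_const (half_pos hε), eventually_ge_atTop q] with n hn hqn
  have hLpos : 0 < n / q := Nat.div_pos hqn (by omega)
  have hLq : n / q * q ≤ n := Nat.div_mul_le_self n q
  have hL4 : 4 * (n / q) ≤ n := by nlinarith
  have hn2 : n ≤ 2 * q * (n / q) := by
    have h1 := Nat.div_add_mod n q
    have h2 := Nat.mod_lt n (by omega : q > 0)
    nlinarith
  set L := n / q with hL
  have hLq' : (L : ℝ) * q ≤ n := by exact_mod_cast hLq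
  have hn2' : (n : ℝ) ≤ 2 * q * L := by exact_mod_cast hn2
  have hL0 : (0 : ℝ) < L := by exact_mod_cast hLpos
  have hn0 : (1 : ℝ) ≤ n := by exact_mod_cast (by omega : 1 ≤ n)
  refine (cornerLeak_le k hL4 hLpos).trans (ENNReal.ofReal_le_ofReal ?_)
  have hs1 : 1 ≤ √(2 * (n : ℝ)) := Real.one_le_sqrt.2 (by linarith)
  have hb0 : 0 ≤ 1 - (L : ℝ) / (2 * n) := by
    rw [sub_nonneg]
    refine div_le_one_of_le₀ ?_ (by positivity)
    exact_mod_cast (by omega : L ≤ 2 * n)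
  have hle1 : (1 - (L : ℝ) / (2 * n)) ^ L ≤ r ^ L := by
    refine pow_le_pow_left₀ hb0 (sub_le_sub_left ?_ _) _
    rw [div_le_div_iff₀ (by positivity) (by positivity)]
    linarith
  have hle2 : 2 * (n : ℝ) / L ≤ 4 * q := by
    rw [div_le_iff₀ hL0]
    linarith
  have h1 : n * ((1 - (L : ℝ) / (2 * n)) ^ L * (2 * n / L)) ≤ ε / 2 * √(2 * n) := by
    calc n * ((1 - (L : ℝ) / (2 * n)) ^ L * (2 * n / L)) ≤
        (2 * q * L) * (r ^ L * (4 * q)) :=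
          mul_le_mul hn2' (mul_le_mul hle1 hle2 (by positivity) (by positivity))
            (mul_nonneg (pow_nonneg hb0 _) (by positivity)) (by positivity)
      _ = 8 * q ^ 2 * (L * r ^ L) := by ring
      _ ≤ ε / 2 := hn
      _ ≤ _ := le_mul_of_one_le_right (by positivity) hs1
  have h2 : 2 * L * (2 * (1 / √((n : ℝ) / 2))) ≤ ε / 2 * √(2 * n) := by
    have e : √(2 * (n : ℝ)) = 2 * √((n : ℝ) / 2) := by
      rw [show 2 * (n : ℝ) = 2 ^ 2 * (n / 2) by ring, Real.sqrt_mul (by positivity),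
        Real.sqrt_sq (by norm_num)]
    have e2 : √((n : ℝ) / 2) * √((n : ℝ) / 2) = n / 2 := Real.mul_self_sqrt (by positivity)
    have hp : 0 < √((n : ℝ) / 2) := by positivity
    rw [e, mul_one_div, ← mul_div_assoc, div_le_iff₀ hp]
    rw [div_lt_iff₀ hε] at hqε
    nlinarith [mul_le_mul_of_nonneg_left hLq' hε.le, mul_lt_mul_of_pos_right hqε hL0]
  linarith

lemma tendsto_trace_ginibreM_pow (m : ℕ) :
    Tendsto (fun n : ℕ => (ginibreM n ^ (m + 1)).trace / √(2 * n)) atTop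
      (𝓝 (1 / √(2 * Real.pi * (m + 1)))) := by
  have hS := tendsto_cornerTrace m
  refine tendsto_order.2 ⟨fun x hx => ?_, fun x hx => ?_⟩
  · set ε := (1 / √(2 * Real.pi * (m + 1)) - x) / 2 with hε
    have hε0 : 0 < ε := by rw [hε]; linarith
    have hx' : x + ε < 1 / √(2 * Real.pi * (m + 1)) := by rw [hε]; linarith
    filter_upwards [hS.eventually_const_lt hx', eventually_gt_atTop 0,
      cornerLeak_eventually_le m (ε := ε / (m + 1)) (by positivity)] with n hn hn0 hleak
    have hs : 0 < √(2 * (n : ℝ)) := by positivity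
    have h1 : cornerTrace (m + 1) n ≤ (ginibreM n ^ (m + 1)).trace + ε * √(2 * n) := by
      have hsum : ENNReal.ofReal (ginibreM n ^ (m + 1)).trace =
          ∑ a : Fin n, ENNReal.ofReal ((ginibreM n ^ (m + 1)) a a) :=
        ENNReal.ofReal_sum_of_nonneg fun i _ => ginibreM_pow_nonneg n _ i i
      have htr : 0 ≤ (ginibreM n ^ (m + 1)).trace :=
        Finset.sum_nonneg fun i _ => ginibreM_pow_nonneg n _ i i
      rw [cornerTrace, ← Fin.sum_univ_eq_sum_range (fun a => (ginibrePow (m + 1) a a).toReal) n,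
        ← ENNReal.toReal_sum fun a _ => ginibrePow_ne_top _ _ _]
      refine ENNReal.toReal_le_of_le_ofReal (by positivity) ?_
      refine (sum_ginibrePow_self_le n m).trans ?_
      rw [ENNReal.ofReal_add htr (by positivity), hsum]
      refine add_le_add le_rfl ?_
      calc ((m : ℝ≥0∞) + 1) * cornerLeak m n ≤ ENNReal.ofReal ((m : ℝ) + 1) *
            ENNReal.ofReal (ε / (m + 1) * √(2 * n)) := by
            refine mul_le_mul' (le_of_eq ?_) hleak
            rw [ENNReal.ofReal_add (by positivity) zero_le_one, ENNReal.ofReal_natCast,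
              ENNReal.ofReal_one]
        _ = _ := by
            rw [← ENNReal.ofReal_mul (by positivity)]
            congr 1
            field_simp
    rw [lt_div_iff₀ hs] at hn ⊢
    linarith
  · filter_upwards [hS.eventually_lt_const hx] with n hn
    refine lt_of_le_of_lt ?_ hn
    gcongr
    exact trace_ginibreM_pow_le n (m + 1)

namespace Matrix.IsHermitian

variable {n : Type*} [Fintype n] [DecidableEq n] {A : Matrix n n ℝ}

lemma trace_pow_eq_sum_eigenvalues (hA : A.IsHermitian) (m : ℕ) :
    (A ^ m).trace = ∑ i, hA.eigenvalues i ^ m := by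
  have h := congrArg (· ^ m) hA.spectral_theorem
  simp only [← map_pow, Matrix.diagonal_pow] at h
  rw [h, Unitary.conjStarAlgAut_apply, Matrix.trace_mul_comm, ← mul_assoc, Unitary.coe_star_mul_self,
    one_mul, Matrix.trace_diagonal]
  rfl

lemma det_one_add_smul (hA : A.IsHermitian) (z : ℝ) :
    (1 + (z - 1) • A).det = ∏ i, (hA.eigenvalues i * z + (1 - hA.eigenvalues i)) := by
  set D : Matrix n n ℝ := Matrix.diagonal hA.eigenvalues with hD
  set U : Matrix n n ℝ := hA.eigenvectorUnitary.1 with hU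
  have hUU : star U * U = 1 := Unitary.coe_star_mul_self _
  have hUU' : U * star U = 1 := Unitary.coe_mul_star_self _
  have h : A = U * D * star U := by
    conv_lhs => rw [hA.spectral_theorem, Unitary.conjStarAlgAut_apply]
    rfl
  have h1 : 1 + (z - 1) • A = U * (1 + (z - 1) • D) * star U := by
    rw [mul_add, add_mul, mul_one, hUU', mul_smul_comm, smul_mul_assoc, ← h]
  have h2 : 1 + (z - 1) • D =
      Matrix.diagonal fun i => hA.eigenvalues i * z + (1 - hA.eigenvalues i) := by
    ext i j
    rcases eq_or_ne i j with rfl | hij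
    · simp [hD]
      ring
    · simp [hD, hij]
  rw [h1, Matrix.det_mul_comm, ← mul_assoc, hUU, one_mul, h2, Matrix.det_diagonal]

open Polynomial in
lemma det_one_add_X_sub_one_smul (hA : A.IsHermitian) :
    ((1 : Matrix n n ℝ[X]) + (X - 1 : ℝ[X]) • A.map C).det =
      ∏ i, (C (hA.eigenvalues i) * X + C (1 - hA.eigenvalues i)) := by
  refine Polynomial.funext fun z => ?_
  rw [Polynomial.eval_prod, ← Polynomial.coe_evalRingHom, RingHom.map_det]
  have h : (Polynomial.evalRingHom z).mapMatrix
      ((1 : Matrix n n ℝ[X]) + (X - 1 : ℝ[X]) • A.map C) = 1 + (z - 1) • A := by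
    ext i j
    simp [Matrix.one_apply, apply_ite (Polynomial.eval z)]
  rw [h, hA.det_one_add_smul]
  simp

end Matrix.IsHermitian

lemma ginibreM_isHermitian (n : ℕ) : (ginibreM n).IsHermitian := by
  ext i j
  rw [Matrix.conjTranspose_apply, star_trivial, ginibreM_apply, ginibreM_apply, ginibreEntry_comm]

lemma ginibreM_posSemidef (n : ℕ) : (ginibreM n).PosSemidef := by
  refine .of_dotProduct_mulVec_nonneg (ginibreM_isHermitian n) fun x => ?_
  have h : star x ⬝ᵥ (ginibreM n).mulVec x =
      1 / √(2 * Real.pi) * ∫ t, (∑ i, x i * evenGauss i t) ^ 2 := by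
    have e (t : ℝ) : (∑ i, x i * evenGauss i t) ^ 2 =
        ∑ i, ∑ j, x i * x j * (evenGauss i t * evenGauss j t) := by
      rw [sq, Finset.sum_mul_sum]
      exact Finset.sum_congr rfl fun i _ => Finset.sum_congr rfl fun j _ => by ring
    simp only [e]
    rw [integral_finsetSum _ fun i _ => integrable_finsetSum _ fun j _ =>
      (evenGauss.integrable_mul _ _).const_mul _, Finset.mul_sum, dotProduct]
    refine Finset.sum_congr rfl fun i _ => ?_
    rw [integral_finsetSum _ fun j _ => (evenGauss.integrable_mul _ _).const_mul _, Finset.mul_sum,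
      Matrix.mulVec, dotProduct, Finset.mul_sum]
    refine Finset.sum_congr rfl fun j _ => ?_
    rw [integral_const_mul, ginibreM_apply, ← evenGauss.integral_mul, Pi.star_apply, star_trivial]
    ring
  rw [h]
  exact mul_nonneg (by positivity) (integral_nonneg fun t => sq_nonneg _)

/-- The eigenvalues of `ginibreM n`. -/
noncomputable def ginibreEigenvalue (n : ℕ) (i : Fin n) : ℝ :=
  (ginibreM_isHermitian n).eigenvalues i

namespace ginibreEigenvalue

lemma sum_pow (n m : ℕ) : ∑ i, ginibreEigenvalue n i ^ m = (ginibreM n ^ m).trace :=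
  ((ginibreM_isHermitian n).trace_pow_eq_sum_eigenvalues m).symm

lemma nonneg (n : ℕ) (i : Fin n) : 0 ≤ ginibreEigenvalue n i :=
  (ginibreM_posSemidef n).eigenvalues_nonneg i

lemma sum_pow_le (n m : ℕ) : ∑ i, ginibreEigenvalue n i ^ (m + 1) ≤ 4 * √n / √(m + 1) := by
  rw [sum_pow]
  refine ((trace_ginibreM_pow_le n (m + 1)).trans (cornerTrace_le m.succ_ne_zero n)).trans
    (le_of_eq ?_)
  push_cast
  rfl

lemma lt_one (n : ℕ) (i : Fin n) : ginibreEigenvalue n i < 1 := by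
  by_contra! h
  have h1 (m : ℕ) : 1 ≤ 4 * √n / √((m : ℝ) + 1) :=
    (one_le_pow₀ h).trans ((Finset.single_le_sum
      (fun j _ => pow_nonneg (nonneg n j) (m + 1)) (Finset.mem_univ i)).trans (sum_pow_le n m))
  have h2 : Tendsto (fun m : ℕ => 4 * √n / √((m : ℝ) + 1)) atTop (𝓝 0) :=
    (Real.tendsto_sqrt_atTop.comp
      (tendsto_atTop_add_const_right _ _ tendsto_natCast_atTop_atTop)).const_div_atTop _
  exact absurd (ge_of_tendsto' h2 h1) (by norm_num)

end ginibreEigenvalue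

lemma ginibreCoeff_eq (n k : ℕ) : ginibreCoeff n k =
    ∑ t : Finset (Fin n), if k = t.card then
      (∏ i ∈ t, ginibreEigenvalue n i) * ∏ i ∈ tᶜ, (1 - ginibreEigenvalue n i) else 0 := by
  rw [ginibreCoeff, (ginibreM_isHermitian n).det_one_add_X_sub_one_smul, Fintype.prod_add,
    Polynomial.finsetSum_coeff]
  refine Finset.sum_congr rfl fun t _ => ?_
  rw [Finset.prod_mul_distrib, Finset.prod_const, ← map_prod, ← map_prod, mul_right_comm, ← map_mul,
    Polynomial.coeff_C_mul_X_pow]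
  rfl

lemma ginibreCoeff_mul_pow_le (n k : ℕ) {z : ℝ} (h0 : 0 ≤ z) :
    ginibreCoeff n k * z ^ k ≤
      ∏ i, (ginibreEigenvalue n i * z + (1 - ginibreEigenvalue n i)) := by
  rw [ginibreCoeff_eq, Finset.sum_mul, Fintype.prod_add]
  refine Finset.sum_le_sum fun t _ => ?_
  have hz : 0 ≤ z ^ t.card := pow_nonneg h0 _
  have h1 : 0 ≤ ∏ i ∈ t, ginibreEigenvalue n i :=
    Finset.prod_nonneg fun i _ => ginibreEigenvalue.nonneg n i
  have h2 : 0 ≤ ∏ i ∈ tᶜ, (1 - ginibreEigenvalue n i) :=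
    Finset.prod_nonneg fun i _ => sub_nonneg.2 (ginibreEigenvalue.lt_one n i).le
  rw [Finset.prod_mul_distrib, Finset.prod_const]
  split_ifs with h
  · rw [h]
    exact le_of_eq (by ring)
  · rw [zero_mul]
    positivity

lemma le_ginibreCoeff {n k : ℕ} {s : Finset (Fin n)} (hs : s.card = k)
    (h : ∀ i ∈ s, 1 / 2 ≤ ginibreEigenvalue n i) :
    (1 / 2) ^ k * ∏ i, (1 - ginibreEigenvalue n i) ≤ ginibreCoeff n k := by
  have hp (t : Finset (Fin n)) : 0 ≤ ∏ i ∈ t, (1 - ginibreEigenvalue n i) :=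
    Finset.prod_nonneg fun i _ => sub_nonneg.2 (ginibreEigenvalue.lt_one n i).le
  have hq (t : Finset (Fin n)) : 0 ≤ ∏ i ∈ t, ginibreEigenvalue n i :=
    Finset.prod_nonneg fun i _ => ginibreEigenvalue.nonneg n i
  have h1 : (1 / 2 : ℝ) ^ k ≤ ∏ i ∈ s, ginibreEigenvalue n i := by
    rw [← hs, ← Finset.prod_const]
    exact Finset.prod_le_prod (fun _ _ => by norm_num) h
  have h2 : ∏ i, (1 - ginibreEigenvalue n i) ≤ ∏ i ∈ sᶜ, (1 - ginibreEigenvalue n i) := by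
    rw [← Finset.prod_mul_prod_compl s]
    refine mul_le_of_le_one_left (hp _) (Finset.prod_le_one (fun i _ =>
      sub_nonneg.2 (ginibreEigenvalue.lt_one n i).le) fun i _ => ?_)
    linarith [ginibreEigenvalue.nonneg n i]
  rw [ginibreCoeff_eq]
  refine (mul_le_mul h1 h2 (hp _) (hq _)).trans (le_trans (le_of_eq ?_) (Finset.single_le_sum
    (f := fun t : Finset (Fin n) => if k = t.card then
      (∏ i ∈ t, ginibreEigenvalue n i) * ∏ i ∈ tᶜ, (1 - ginibreEigenvalue n i) else 0)
    (fun t _ => ?_) (Finset.mem_univ s)))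
  · simp only [hs, if_true]
  · split_ifs
    · exact mul_nonneg (hq _) (hp _)
    · exact le_rfl

lemma tendsto_card_half_le_ginibreEigenvalue :
    Tendsto (fun n : ℕ => (Finset.univ.filter fun i => 1 / 2 ≤ ginibreEigenvalue n i).card)
      atTop atTop := by
  have hle (n : ℕ) : (ginibreM n ^ 2).trace - 1 / 2 * (ginibreM n ^ 1).trace ≤
      ((Finset.univ.filter fun i => 1 / 2 ≤ ginibreEigenvalue n i).card : ℝ) := by
    rw [← ginibreEigenvalue.sum_pow, ← ginibreEigenvalue.sum_pow, Finset.mul_sum,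
      ← Finset.sum_sub_distrib, Finset.card_filter, Nat.cast_sum]
    refine Finset.sum_le_sum fun i _ => ?_
    have h0 := ginibreEigenvalue.nonneg n i
    have h1 := ginibreEigenvalue.lt_one n i
    split_ifs with h
    · push_cast
      nlinarith
    · push_cast
      nlinarith
  rw [← tendsto_natCast_atTop_iff (R := ℝ)]
  refine tendsto_atTop_mono hle ?_
  have hlim := (tendsto_trace_ginibreM_pow 1).sub
    ((tendsto_trace_ginibreM_pow 0).const_mul (1 / 2))
  have hpos : 0 < 1 / √(2 * Real.pi * ((1 : ℕ) + 1)) -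
      1 / 2 * (1 / √(2 * Real.pi * ((0 : ℕ) + 1))) := by
    have hsq : √2 < 2 := by
      rw [Real.sqrt_lt' (by norm_num)]
      norm_num
    have hpi : 0 < √(2 * Real.pi) := by positivity
    have e : 1 / √(2 * Real.pi * ((1 : ℕ) + 1)) - 1 / 2 * (1 / √(2 * Real.pi * ((0 : ℕ) + 1))) =
        1 / √(2 * Real.pi) * (1 / √2 - 1 / 2) := by
      rw [show ((1 : ℕ) : ℝ) + 1 = 2 by norm_num, Real.sqrt_mul (by positivity), Nat.cast_zero,
        zero_add, mul_one]
      field_simp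
    rw [e]
    exact mul_pos (by positivity) (sub_pos.2 (one_div_lt_one_div_of_lt (by positivity) hsq))
  have hs : Tendsto (fun n : ℕ => √(2 * (n : ℝ))) atTop atTop :=
    Real.tendsto_sqrt_atTop.comp (tendsto_natCast_atTop_atTop.const_mul_atTop two_pos)
  refine (hlim.pos_mul_atTop hpos hs).congr' ?_
  filter_upwards [eventually_gt_atTop 0] with n hn
  have : √(2 * (n : ℝ)) ≠ 0 := by positivity
  field_simp

lemma hasSum_log_det (n : ℕ) : HasSum (fun m : ℕ => (ginibreM n ^ (m + 1)).trace / (m + 1))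
    (-∑ i, Real.log (1 - ginibreEigenvalue n i)) := by
  have h := hasSum_sum fun (i : Fin n) (_ : i ∈ Finset.univ) =>
    Real.hasSum_pow_div_log_of_abs_lt_one (x := ginibreEigenvalue n i)
      (by rw [abs_of_nonneg (ginibreEigenvalue.nonneg n i)]; exact ginibreEigenvalue.lt_one n i)
  simpa only [← Finset.sum_div, ginibreEigenvalue.sum_pow, Finset.sum_neg_distrib] using h

lemma one_div_mul_sqrt_eq_rpow (m : ℕ) :
    1 / (((m : ℝ) + 1) * √((m : ℝ) + 1)) = ((m + 1 : ℕ) : ℝ) ^ (-(3 / 2) : ℝ) := by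
  have h : (0 : ℝ) < (m : ℝ) + 1 := by positivity
  rw [Nat.cast_succ, Real.rpow_neg h.le, show (3 / 2 : ℝ) = 1 + 1 / 2 by norm_num,
    Real.rpow_add h, Real.rpow_one, ← Real.sqrt_eq_rpow, one_div]

lemma summable_one_div_mul_sqrt :
    Summable fun m : ℕ => 1 / (((m : ℝ) + 1) * √((m : ℝ) + 1)) := by
  simp only [one_div_mul_sqrt_eq_rpow]
  exact (summable_nat_add_iff 1).2 (Real.summable_nat_rpow.2 (by norm_num))

lemma one_div_sqrt_div_eq (m : ℕ) : 1 / √(2 * Real.pi * (m + 1)) / (m + 1) =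
    1 / √(2 * Real.pi) * (1 / (((m : ℝ) + 1) * √((m : ℝ) + 1))) := by
  rw [Real.sqrt_mul (by positivity)]
  field_simp

/-- The limiting constant, `ζ(3/2) / √(2π)`. -/
noncomputable def ginibreRate : ℝ := 1 / √(2 * Real.pi) * ∑' m : ℕ+, (m : ℝ) ^ (-(3 / 2) : ℝ)

lemma hasSum_ginibreRate :
    HasSum (fun m : ℕ => 1 / √(2 * Real.pi * (m + 1)) / (m + 1)) ginibreRate := by
  have h : ginibreRate = 1 / √(2 * Real.pi) * ∑' m : ℕ, 1 / (((m : ℝ) + 1) * √((m : ℝ) + 1)) := by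
    simp only [ginibreRate, one_div_mul_sqrt_eq_rpow]
    rw [tsum_pnat_eq_tsum_succ (f := fun m : ℕ => (m : ℝ) ^ (-(3 / 2) : ℝ))]
  rw [h]
  simp only [one_div_sqrt_div_eq]
  exact summable_one_div_mul_sqrt.hasSum.mul_left _

lemma tendsto_log_det :
    Tendsto (fun n : ℕ => (∑ i, Real.log (1 - ginibreEigenvalue n i)) / √(2 * n)) atTop
      (𝓝 (-ginibreRate)) := by
  have hterm (m : ℕ) : Tendsto (fun n : ℕ => (ginibreM n ^ (m + 1)).trace / (m + 1) / √(2 * n))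
      atTop (𝓝 (1 / √(2 * Real.pi * (m + 1)) / (m + 1))) := by
    simpa only [div_right_comm] using (tendsto_trace_ginibreM_pow m).div_const ((m : ℝ) + 1)
  have hbound (n m : ℕ) : ‖(ginibreM n ^ (m + 1)).trace / (m + 1) / √(2 * n)‖ ≤
      4 * (1 / (((m : ℝ) + 1) * √((m : ℝ) + 1))) := by
    have h0 : 0 ≤ (ginibreM n ^ (m + 1)).trace :=
      Finset.sum_nonneg fun i _ => ginibreM_pow_nonneg n _ i i
    have h1 := ginibreEigenvalue.sum_pow_le n m
    rw [ginibreEigenvalue.sum_pow] at h1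
    rw [Real.norm_of_nonneg (by positivity)]
    have h2 : √(n : ℝ) ≤ √(2 * n) := Real.sqrt_le_sqrt (by linarith [n.cast_nonneg (α := ℝ)])
    refine div_le_of_le_mul₀ (Real.sqrt_nonneg _) (by positivity) ?_
    calc _ ≤ 4 * √n / √(m + 1) / (m + 1) := by gcongr
      _ ≤ 4 * √(2 * n) / √(m + 1) / (m + 1) := by gcongr
      _ = _ := by field_simp
  have h := tendsto_tsum_of_dominated_convergence (summable_one_div_mul_sqrt.mul_left 4) hterm
    (Eventually.of_forall hbound)
  rw [hasSum_ginibreRate.tsum_eq] at h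
  refine h.neg.congr fun n => ?_
  rw [((hasSum_log_det n).div_const _).tsum_eq]
  ring

lemma ginibreCoeff_eventually_ge (k : ℕ) : ∀ᶠ n : ℕ in atTop, 0 < ginibreCoeff n k ∧
    k * Real.log (1 / 2) + ∑ i, Real.log (1 - ginibreEigenvalue n i) ≤
      Real.log (ginibreCoeff n k) := by
  filter_upwards [tendsto_card_half_le_ginibreEigenvalue.eventually_ge_atTop k] with n hn
  obtain ⟨s, hs, hcard⟩ := Finset.exists_subset_card_eq hn
  have h := le_ginibreCoeff hcard fun i hi => (Finset.mem_filter.1 (hs hi)).2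
  have hpos (i : Fin n) : 0 < 1 - ginibreEigenvalue n i := sub_pos.2 (ginibreEigenvalue.lt_one n i)
  have hp : 0 < ∏ i, (1 - ginibreEigenvalue n i) := Finset.prod_pos fun i _ => hpos i
  refine ⟨lt_of_lt_of_le (by positivity) h, ?_⟩
  rw [← Real.log_pow, ← Real.log_prod fun i _ => (hpos i).ne',
    ← Real.log_mul (by positivity) hp.ne']
  exact Real.log_le_log (by positivity) h

lemma log_ginibreCoeff_le {n k : ℕ} (hpos : 0 < ginibreCoeff n k) {z : ℝ} (h0 : 0 < z) (h1 : z ≤ 1)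
    (K : ℕ) : Real.log (ginibreCoeff n k) ≤ -(k * Real.log z) -
      ∑ m ∈ Finset.range K, (1 - z) ^ (m + 1) * ((ginibreM n ^ (m + 1)).trace / (m + 1)) := by
  have hx0 (i : Fin n) : 0 ≤ (1 - z) * ginibreEigenvalue n i :=
    mul_nonneg (sub_nonneg.2 h1) (ginibreEigenvalue.nonneg n i)
  have hx1 (i : Fin n) : (1 - z) * ginibreEigenvalue n i < 1 := by
    nlinarith [ginibreEigenvalue.nonneg n i, ginibreEigenvalue.lt_one n i]
  have hlog (i : Fin n) : Real.log (1 - (1 - z) * ginibreEigenvalue n i) ≤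
      -∑ m ∈ Finset.range K, ((1 - z) * ginibreEigenvalue n i) ^ (m + 1) / (m + 1) := by
    have := sum_le_hasSum (Finset.range K) (fun m _ => div_nonneg (pow_nonneg (hx0 i) (m + 1))
      (by positivity)) (Real.hasSum_pow_div_log_of_abs_lt_one
        (by rw [abs_of_nonneg (hx0 i)]; exact hx1 i))
    linarith
  have h := Real.log_le_log (by positivity) (ginibreCoeff_mul_pow_le n k h0.le)
  have e (i : Fin n) : ginibreEigenvalue n i * z + (1 - ginibreEigenvalue n i) =
      1 - (1 - z) * ginibreEigenvalue n i := by ring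
  simp only [e] at h
  rw [Real.log_mul hpos.ne' (by positivity), Real.log_pow,
    Real.log_prod fun i _ => (sub_pos.2 (hx1 i)).ne'] at h
  have hsum : ∑ i, -∑ m ∈ Finset.range K, ((1 - z) * ginibreEigenvalue n i) ^ (m + 1) / (m + 1) =
      -∑ m ∈ Finset.range K, (1 - z) ^ (m + 1) * ((ginibreM n ^ (m + 1)).trace / ((m : ℝ) + 1)) := by
    rw [Finset.sum_neg_distrib, Finset.sum_comm]
    congr 1
    refine Finset.sum_congr rfl fun m _ => ?_
    rw [← ginibreEigenvalue.sum_pow, Finset.sum_div, Finset.mul_sum]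
    exact Finset.sum_congr rfl fun i _ => by rw [mul_pow, mul_div_assoc]
  have := (Finset.sum_le_sum fun i (_ : i ∈ Finset.univ) => hlog i).trans_eq hsum
  linarith

lemma tendsto_const_div_sqrt_two_mul (c : ℝ) :
    Tendsto (fun n : ℕ => c / √(2 * (n : ℝ))) atTop (𝓝 0) :=
  (Real.tendsto_sqrt_atTop.comp
    (tendsto_natCast_atTop_atTop.const_mul_atTop two_pos)).const_div_atTop _

lemma tendsto_log_ginibreCoeff (k : ℕ) :
    Tendsto (fun n : ℕ => Real.log (ginibreCoeff n k) / √(2 * n)) atTop (𝓝 (-ginibreRate)) := by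
  refine tendsto_order.2 ⟨fun x hx => ?_, fun x hx => ?_⟩
  · have h := (tendsto_const_div_sqrt_two_mul (k * Real.log (1 / 2))).add tendsto_log_det
    rw [zero_add] at h
    filter_upwards [h.eventually_const_lt hx, ginibreCoeff_eventually_ge k] with n hn hk
    refine hn.trans_le ?_
    rw [← add_div]
    gcongr
    exact hk.2
  · obtain ⟨K, hK⟩ := (hasSum_ginibreRate.tendsto_sum_nat.eventually_const_lt
      (neg_lt.1 hx)).exists
    have hcont : Continuous fun z : ℝ => ∑ m ∈ Finset.range K,
        (1 - z) ^ (m + 1) * (1 / √(2 * Real.pi * (m + 1)) / (m + 1)) := by fun_prop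
    have hz := (hcont.tendsto 0).mono_left (nhdsWithin_le_nhds (s := Set.Ioi 0))
    simp only [sub_zero, one_pow, one_mul] at hz
    obtain ⟨z, hz, hz0, hz1⟩ := ((hz.eventually_const_lt hK).and
      (Ioc_mem_nhdsGT (zero_lt_one (α := ℝ)))).exists
    have hterm : Tendsto (fun n : ℕ => -(k * Real.log z) / √(2 * (n : ℝ)) -
        ∑ m ∈ Finset.range K, (1 - z) ^ (m + 1) *
          ((ginibreM n ^ (m + 1)).trace / √(2 * n) / (m + 1))) atTop
        (𝓝 (0 - ∑ m ∈ Finset.range K,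
          (1 - z) ^ (m + 1) * (1 / √(2 * Real.pi * (m + 1)) / (m + 1)))) :=
      (tendsto_const_div_sqrt_two_mul _).sub (tendsto_finsetSum _ fun m _ =>
        ((tendsto_trace_ginibreM_pow m).div_const _).const_mul _)
    filter_upwards [hterm.eventually_lt_const (by linarith : _ < x),
      ginibreCoeff_eventually_ge k] with n hn hk
    refine lt_of_le_of_lt ?_ hn
    have e : -(k * Real.log z) / √(2 * (n : ℝ)) - ∑ m ∈ Finset.range K, (1 - z) ^ (m + 1) *
          ((ginibreM n ^ (m + 1)).trace / √(2 * n) / (m + 1)) =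
        (-(k * Real.log z) - ∑ m ∈ Finset.range K, (1 - z) ^ (m + 1) *
          ((ginibreM n ^ (m + 1)).trace / (m + 1))) / √(2 * n) := by
      rw [sub_div, Finset.sum_div]
      congr 1
      exact Finset.sum_congr rfl fun m _ => by rw [mul_div_assoc, div_right_comm]
    rw [e]
    gcongr
    exact log_ginibreCoeff_le hk.1 hz0 hz1 K

theorem stmt1 (k : ℕ) :
    Filter.Tendsto
      (fun n : ℕ => (1 / Real.sqrt (2 * n)) * Real.log (ginibreCoeff n k))
      Filter.atTop
      (nhds (-(1 / Real.sqrt (2 * Real.pi)) * ∑' m : ℕ+, (m : ℝ) ^ (-(3 / 2) : ℝ))) := by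
  have h := tendsto_log_ginibreCoeff k
  rw [ginibreRate, ← neg_mul] at h
  simpa only [one_div_mul_eq_div] using h
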